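/- arXiv:2111.13170 — 4 statements merged into one kernel-verified Lean document; each statement's English description precedes it below -/
import Mathlib

section
/- Let V be a quadratic space of maximal Witt index over a field of characteristic ≠ 2, with 0 < k < dim V. Then the set of decomposable k-vectors v ∧ v_2 ∧ ⋯ ∧ v_k, where v is a nonzero isotropic vector and v_2, …, v_k ∈ v^⊥, spans the entire exterior power Λ^k V. -/
open ExteriorAlgebra

section Preamble

variable {K V : Type} [Field K] [AddCommGroup V] [Module K V]

/-- A subspace is isotropic for the bilinear form `B`. -/
def IsotropicSub (B : LinearMap.BilinForm K V) (W : Submodule K V) : Prop :=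
  ∀ x ∈ W, ∀ y ∈ W, B x y = 0

/-- A subspace is maximal isotropic for `B`. -/
def MaxIsotropic (B : LinearMap.BilinForm K V) (W : Submodule K V) : Prop :=
  IsotropicSub B W ∧ ∀ W' : Submodule K V, IsotropicSub B W' → W ≤ W' → W' = W

/-- `V` has maximal Witt index `⌊dim V / 2⌋`. -/
def MaxWittIndex (B : LinearMap.BilinForm K V) : Prop :=
  ∃ W : Submodule K V, IsotropicSub B W ∧
    Module.finrank K ↥W = Module.finrank K V / 2

/-- The orthogonal complement `v^⊥` of a vector. -/
def perpV (B : LinearMap.BilinForm K V) (v : V) : Submodule K V :=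
  LinearMap.ker (B v)

/-- The line spanned by `v`, viewed inside `v^⊥`. -/
def lineIn (B : LinearMap.BilinForm K V) (v : V) : Submodule K ↥(perpV B v) :=
  Submodule.comap (perpV B v).subtype (Submodule.span K {v})

/-- The quotient `V_v = v^⊥/⟨v⟩`. -/
abbrev Qt (B : LinearMap.BilinForm K V) (v : V) : Type :=
  ↥(perpV B v) ⧸ lineIn B v

/-- The projection `v^⊥ → v^⊥/⟨v⟩`. -/
def projQ (B : LinearMap.BilinForm K V) (v : V) : ↥(perpV B v) →ₗ[K] Qt B v :=
  (lineIn B v).mkQ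

/-- `π : V → V_v` is a linear extension of the canonical projection `v^⊥ → V_v`. -/
def ExtendsProj (B : LinearMap.BilinForm K V) (v : V) (π : V →ₗ[K] Qt B v) : Prop :=
  ∀ x : ↥(perpV B v), π x.val = projQ B v x

/-- The isotropic-Grassmann-cone-preserving map `Φ_v`, defined as contraction by `⟨v,·⟩`
followed by the map induced by (an extension of) the projection `v^⊥ → v^⊥/⟨v⟩`.
Its restriction to `⋀^k V` does not depend on the chosen extension `π`. -/
noncomputable def Phi (B : LinearMap.BilinForm K V) (v : V) (π : V →ₗ[K] Qt B v) :
    ExteriorAlgebra K V →ₗ[K] ExteriorAlgebra K (Qt B v) :=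
  (ExteriorAlgebra.map π).toLinearMap ∘ₗ
    (CliffordAlgebra.contractLeft (Q := (0 : QuadraticForm K V)) (B v))

/-- The span of the decomposable `m`-vectors with factors in `W`, i.e. `⋀^m W` viewed
inside `⋀^m V`. -/
def epowSub (K : Type) [Field K] {V : Type} [AddCommGroup V] [Module K V]
    (W : Submodule K V) (m : ℕ) : Submodule K (ExteriorAlgebra K V) :=
  Submodule.span K {x | ∃ w : Fin m → V, (∀ i, w i ∈ W) ∧ x = ExteriorAlgebra.ιMulti K m w}

end Preamble

set_option linter.unusedSimpArgs false

theorem aux_mem {K V : Type} [Field K] [AddCommGroup V] [Module K V]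
    (B : LinearMap.BilinForm K V) (n : ℕ) (S : Submodule K (ExteriorAlgebra K V))
    (hS : ∀ w : Fin (n + 1) → V, w 0 ≠ 0 → B (w 0) (w 0) = 0 → (∀ j, B (w 0) (w j) = 0) →
      ExteriorAlgebra.ιMulti K (n + 1) w ∈ S)
    (w : Fin (n + 1) → V) (a : Fin (n + 1)) (h0 : w a ≠ 0) (h : ∀ j, B (w a) (w j) = 0) :
    ExteriorAlgebra.ιMulti K (n + 1) w ∈ S := by
  by_cases ha : a = 0
  · subst ha
    exact hS w h0 (h _) h
  · have h1 := AlternatingMap.map_swap (ExteriorAlgebra.ιMulti K (n + 1)) w (i := 0) (j := a)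
      (Ne.symm ha)
    have h2 := hS (w ∘ Equiv.swap 0 a) (by simpa using h0) (by simpa using h a)
      (fun j => by simpa using h _)
    rw [h1] at h2
    simpa using S.neg_mem h2

theorem aux_core {K V : Type} [Field K] [AddCommGroup V] [Module K V]
    (h2 : (2 : K) ≠ 0)
    (B : LinearMap.BilinForm K V) (hsymm : ∀ x y, B x y = B y x)
    (n : ℕ) (S : Submodule K (ExteriorAlgebra K V))
    (hS : ∀ w : Fin (n + 1) → V, w 0 ≠ 0 → B (w 0) (w 0) = 0 → (∀ j, B (w 0) (w j) = 0) →
      ExteriorAlgebra.ιMulti K (n + 1) w ∈ S)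
    {ι : Type} (σ : ι → ι) (hσ : ∀ i, σ (σ i) = i)
    (hfix : ∀ i j, σ i = i → σ j = j → i = j)
    (b : ι → V) (hb : ∀ i j, j ≠ σ i → B (b i) (b j) = 0)
    (hb1 : ∀ i, σ i ≠ i → B (b i) (b (σ i)) = 1)
    (hb0 : ∀ i, σ i = i → B (b i) (b i) ≠ 0)
    (u : Fin (n + 1) → ι) (hu : Function.Injective u) (hns : ¬ Function.Surjective u) :
    ExteriorAlgebra.ιMulti K (n + 1) (fun a => b (u a)) ∈ S := by
  classical
  have hA := aux_mem B n S hS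
  have hne : ∀ i, b i ≠ 0 := by
    intro i hi
    by_cases h : σ i = i
    · exact hb0 i h (by simp [hi])
    · have := hb1 i h
      simp [hi] at this
  have hσi : ∀ i j, σ i = σ j → i = j := fun i j h => by rw [← hσ i, h, hσ]
  by_cases hc : ∃ a, ∀ c, u c ≠ σ (u a)
  · obtain ⟨a, ha⟩ := hc
    exact hA _ a (hne _) (fun j => hb _ _ (ha j))
  push Not at hc
  have hself : ∀ i, σ i ≠ i → B (b i) (b i) = 0 := fun i h => hb i i (Ne.symm h)
  set w : Fin (n + 1) → V := fun a => b (u a) with hw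
  -- two-slot function
  have key : ∀ a c, a ≠ c → ∀ x y z, B x x = 0 → B x y = 0 → B x z = 1 →
      (∀ d, d ≠ a → d ≠ c → B x (b (u d)) = 0) →
      ExteriorAlgebra.ιMulti K (n + 1) (Function.update (Function.update w a x) c y) ∈ S := by
    intro a c hac x y z hx hy hz hd
    apply hA _ a
    · simp only [Function.update_of_ne hac, Function.update_self]
      rintro rfl
      simp at hz
    · intro j
      simp only [Function.update_of_ne hac, Function.update_self]
      by_cases hjc : j = c
      · subst hjc; simpa using hy
      · by_cases hja : j = a
        · subst hja; simpa [Function.update_of_ne hjc] using hx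
        · simpa [Function.update_of_ne hjc, Function.update_of_ne hja] using hd j hja hjc
  have hadd1 : ∀ a c, a ≠ c → ∀ x x' y,
      ExteriorAlgebra.ιMulti K (n + 1) (Function.update (Function.update w a (x + x')) c y) =
      ExteriorAlgebra.ιMulti K (n + 1) (Function.update (Function.update w a x) c y) +
      ExteriorAlgebra.ιMulti K (n + 1) (Function.update (Function.update w a x') c y) := by
    intro a c hac x x' y
    simp only [Function.update_comm hac]
    rw [AlternatingMap.map_update_add]
  have hsmul1 : ∀ a c, a ≠ c → ∀ (r : K) x y,
      ExteriorAlgebra.ιMulti K (n + 1) (Function.update (Function.update w a (r • x)) c y) =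
      r • ExteriorAlgebra.ιMulti K (n + 1) (Function.update (Function.update w a x) c y) := by
    intro a c hac r x y
    simp only [Function.update_comm hac]
    rw [AlternatingMap.map_update_smul]
  have hanti : ∀ a c, a ≠ c → ∀ x y,
      ExteriorAlgebra.ιMulti K (n + 1) (Function.update (Function.update w a x) c y) =
      - ExteriorAlgebra.ιMulti K (n + 1) (Function.update (Function.update w a y) c x) := by
    intro a c hac x y
    rw [← AlternatingMap.map_swap _ _ hac]
    congr 1
    ext j
    by_cases hjc : j = c
    · subst hjc; simp [Function.update_of_ne hac]
    · by_cases hja : j = a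
      · subst hja; simp [Function.update_of_ne hac]
      · simp [Equiv.swap_apply_of_ne_of_ne hja hjc, Function.update_of_ne hjc,
          Function.update_of_ne hja]
  have hself2 : ∀ a c, a ≠ c → ∀ x,
      ExteriorAlgebra.ιMulti K (n + 1) (Function.update (Function.update w a x) c x) = 0 := by
    intro a c hac x
    apply AlternatingMap.map_eq_zero_of_eq _ _ (i := a) (j := c) _ hac
    simp [Function.update_of_ne hac]
  -- final rewriting
  have hfin : ∀ a c, ExteriorAlgebra.ιMulti K (n + 1)
      (Function.update (Function.update w a (b (u a))) c (b (u c))) =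
      ExteriorAlgebra.ιMulti K (n + 1) w := by
    intro a c
    congr 1
    have : Function.update w a (b (u a)) = w := Function.update_eq_self a w
    rw [this]
    exact Function.update_eq_self c w
  obtain ⟨j, hj⟩ := not_forall.1 hns
  have hj : ∀ a, u a ≠ j := fun a h => hj ⟨a, h⟩
  by_cases hex : ∃ j, σ j ≠ j ∧ ∀ a, u a ≠ j
  · obtain ⟨j, hjf, hj⟩ := hex
    have hj' : ∀ a, u a ≠ σ j := by
      intro a h
      obtain ⟨c, hc⟩ := hc a
      rw [h, hσ] at hc
      exact hj c hc
    by_cases hex2 : ∃ a, σ (u a) ≠ u a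
    · obtain ⟨a, ha⟩ := hex2
      obtain ⟨c, hc⟩ := hc a
      have hac : a ≠ c := by rintro rfl; exact ha hc.symm
      set i := u a with hi
      have e1 : B (b i) (b i) = 0 := hself _ ha
      have e2 : B (b j) (b j) = 0 := hself _ hjf
      have e3 : B (b (σ i)) (b (σ i)) = 0 := hself _ (by rw [hσ]; exact Ne.symm ha)
      have e4 : B (b (σ j)) (b (σ j)) = 0 := hself _ (by rw [hσ]; exact Ne.symm hjf)
      have e5 : B (b i) (b (σ i)) = 1 := hb1 _ ha
      have e6 : B (b j) (b (σ j)) = 1 := hb1 _ hjf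
      have e5' : B (b (σ i)) (b i) = 1 := by rw [hsymm]; exact e5
      have e6' : B (b (σ j)) (b j) = 1 := by rw [hsymm]; exact e6
      have e7 : B (b i) (b j) = 0 := hb _ _ (by rw [← hc]; exact (hj c).symm)
      have e7' : B (b j) (b i) = 0 := by rw [hsymm]; exact e7
      have e8 : B (b i) (b (σ j)) = 0 := hb _ _ (by rw [← hc]; exact (hj' c).symm)
      have e8' : B (b (σ j)) (b i) = 0 := by rw [hsymm]; exact e8
      have e9 : B (b (σ i)) (b j) = 0 := hb _ _ (by rw [hσ]; exact (hj a).symm)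
      have e9' : B (b j) (b (σ i)) = 0 := by rw [hsymm]; exact e9
      have e10 : B (b (σ i)) (b (σ j)) = 0 := hb _ _ (by rw [hσ]; exact (hj' a).symm)
      have e10' : B (b (σ j)) (b (σ i)) = 0 := by rw [hsymm]; exact e10
      have d1 : ∀ d, d ≠ a → d ≠ c → B (b i) (b (u d)) = 0 := fun d _ h =>
        hb _ _ (by rw [← hc]; exact fun h' => h (hu h'))
      have d2 : ∀ d, d ≠ a → d ≠ c → B (b j) (b (u d)) = 0 := fun d _ _ => hb _ _ (hj' d)
      have d4 : ∀ d, d ≠ a → d ≠ c → B (b (σ j)) (b (u d)) = 0 := fun d _ _ =>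
        hb _ _ (by rw [hσ]; exact hj d)
      have K1 := key a c hac (b i + b j) (b (σ i) + (-1 : K) • b (σ j)) (b (σ i))
        (by simp [e1, e2, e3, e4, e5, e6, e5', e6', e7, e7', e8, e8', e9, e9', e10, e10']) (by simp [e1, e2, e3, e4, e5, e6, e5', e6', e7, e7', e8, e8', e9, e9', e10, e10']) (by simp [e1, e2, e3, e4, e5, e6, e5', e6', e7, e7', e8, e8', e9, e9', e10, e10'])
        (fun d h h' => by simp [d1 d h h', d2 d h h'])
      have K2 := key a c hac (b i + b (σ j)) (b (σ i) + (-1 : K) • b j) (b (σ i))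
        (by simp [e1, e2, e3, e4, e5, e6, e5', e6', e7, e7', e8, e8', e9, e9', e10, e10']) (by simp [e1, e2, e3, e4, e5, e6, e5', e6', e7, e7', e8, e8', e9, e9', e10, e10']) (by simp [e1, e2, e3, e4, e5, e6, e5', e6', e7, e7', e8, e8', e9, e9', e10, e10'])
        (fun d h h' => by simp [d1 d h h', d4 d h h'])
      have K3 := key a c hac (b i) (b (σ j)) (b (σ i)) e1 e8 e5 d1
      have K4 := key a c hac (b i) (b j) (b (σ i)) e1 e7 e5 d1
      have K5 := key a c hac (b j) (b (σ i)) (b (σ j)) e2 e9' e6 d2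
      have K6 := key a c hac (b (σ j)) (b (σ i)) (b j) e4 e10' e6' d4
      have hf := hfin a c
      rw [hc, ← hi] at hf
      rw [← hf]
      rw [hadd1 a c hac, AlternatingMap.map_update_add, AlternatingMap.map_update_add,
        AlternatingMap.map_update_smul, AlternatingMap.map_update_smul] at K1 K2
      rw [hanti a c hac (b (σ j)) (b j)] at K2
      generalize ExteriorAlgebra.ιMulti K (n + 1)
        (Function.update (Function.update w a (b i)) c (b (σ i))) = X at *
      generalize ExteriorAlgebra.ιMulti K (n + 1)
        (Function.update (Function.update w a (b j)) c (b (σ j))) = Y at *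
      have T := S.smul_mem (2 : K)⁻¹ (S.add_mem (S.sub_mem (S.add_mem (S.add_mem K1 K2) K3) K5)
        (S.sub_mem K4 K6))
      convert T using 1
      rw [eq_inv_smul_iff₀ h2]
      module
    · push Not at hex2
      have h0 : ∀ a : Fin (n + 1), a = 0 := fun a => hu (hfix _ _ (hex2 a) (hex2 0))
      set g := u 0 with hg
      have gf : σ g = g := hex2 0
      have e2 : B (b j) (b j) = 0 := hself _ hjf
      have e4 : B (b (σ j)) (b (σ j)) = 0 := hself _ (by rw [hσ]; exact Ne.symm hjf)
      have e6 : B (b j) (b (σ j)) = 1 := hb1 _ hjf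
      have e6' : B (b (σ j)) (b j) = 1 := by rw [hsymm]; exact e6
      have e7 : B (b g) (b j) = 0 := hb _ _ (by rw [gf]; exact (hj 0).symm)
      have e7' : B (b j) (b g) = 0 := by rw [hsymm]; exact e7
      have e8 : B (b g) (b (σ j)) = 0 := hb _ _ (by rw [gf]; exact (hj' 0).symm)
      have e8' : B (b (σ j)) (b g) = 0 := by rw [hsymm]; exact e8
      have key1 : ∀ x z, B x x = 0 → B x z = 1 →
          ExteriorAlgebra.ιMulti K (n + 1) (Function.update w 0 x) ∈ S := by
        intro x z hx hz
        apply hA _ 0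
        · simp only [Function.update_self]
          rintro rfl
          simp at hz
        · intro j
          rw [h0 j]
          simpa using hx
      have K1 := key1 (b j + b g + (-(2 : K)⁻¹ * B (b g) (b g)) • b (σ j)) (b (σ j))
        (by simp [e2, e4, e6, e6', e7, e7', e8, e8']; field_simp; ring) (by simp [e2, e4, e6, e6', e7, e7', e8, e8'])
      have K2 := key1 (b j) _ e2 e6
      have K3 := key1 (b (σ j)) _ e4 e6'
      rw [AlternatingMap.map_update_add, AlternatingMap.map_update_add,
        AlternatingMap.map_update_smul] at K1
      have : Function.update w 0 (b g) = w := Function.update_eq_self 0 w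
      rw [this] at K1
      have T := S.sub_mem (S.sub_mem K1 K2) (S.smul_mem (-(2 : K)⁻¹ * B (b g) (b g)) K3)
      convert T using 1
      abel
  · push Not at hex
    have gf : σ j = j := by
      by_contra h
      obtain ⟨a, ha⟩ := hex j h
      exact hj a ha
    have ha : σ (u 0) ≠ u 0 := fun h => hj 0 (hfix _ _ h gf)
    obtain ⟨c, hc⟩ := hc 0
    have hac : 0 ≠ c := by rintro rfl; exact ha hc.symm
    set i := u 0 with hi
    have e0 := hb0 j gf
    have e1 : B (b i) (b i) = 0 := hself _ ha
    have e3 : B (b (σ i)) (b (σ i)) = 0 := hself _ (by rw [hσ]; exact Ne.symm ha)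
    have e5 : B (b i) (b (σ i)) = 1 := hb1 _ ha
    have e5' : B (b (σ i)) (b i) = 1 := by rw [hsymm]; exact e5
    have e7 : B (b i) (b j) = 0 := hb _ _ (by rw [← hc]; exact (hj c).symm)
    have e7' : B (b j) (b i) = 0 := by rw [hsymm]; exact e7
    have e9 : B (b (σ i)) (b j) = 0 := hb _ _ (by rw [hσ]; exact (hj 0).symm)
    have e9' : B (b j) (b (σ i)) = 0 := by rw [hsymm]; exact e9
    have d1 : ∀ d, d ≠ 0 → d ≠ c → B (b i) (b (u d)) = 0 := fun d _ h =>
      hb _ _ (by rw [← hc]; exact fun h' => h (hu h'))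
    have d3 : ∀ d, d ≠ 0 → d ≠ c → B (b (σ i)) (b (u d)) = 0 := fun d h _ =>
      hb _ _ (by rw [hσ]; exact fun h' => h (hu h'))
    have d2 : ∀ d, d ≠ 0 → d ≠ c → B (b j) (b (u d)) = 0 := fun d _ _ =>
      hb _ _ (by rw [gf]; exact hj d)
    obtain ⟨q, hq⟩ : ∃ q, q = B (b j) (b j) := ⟨_, rfl⟩
    rw [← hq] at e0
    have K1 := key 0 c hac (b i + b j + (-(2 : K)⁻¹ * q) • b (σ i)) (b j + (-q) • b (σ i))
      (b (σ i)) (by simp [e1, e3, e5, e5', e7, e7', e9, e9', ← hq]; field_simp; ring) (by simp [e1, e3, e5, e5', e7, e7', e9, e9', ← hq])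
      (by simp [e1, e3, e5, e5', e7, e7', e9, e9', ← hq])
      (fun d h h' => by simp [d1 d h h', d2 d h h', d3 d h h'])
    have K2 := key 0 c hac (b i) (b j) (b (σ i)) e1 e7 e5 d1
    have K3 := key 0 c hac (b (σ i)) (b j) (b i) e3 e9 e5' d3
    have hf := hfin 0 c
    rw [hc, ← hi] at hf
    rw [← hf]
    simp only [hadd1 0 c hac, hsmul1 0 c hac, AlternatingMap.map_update_add,
        AlternatingMap.map_update_smul, hself2 0 c hac] at K1
    rw [hanti 0 c hac (b j) (b (σ i))] at K1
    generalize ExteriorAlgebra.ιMulti K (n + 1)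
        (Function.update (Function.update w 0 (b i)) c (b (σ i))) = X at *
    generalize ExteriorAlgebra.ιMulti K (n + 1)
        (Function.update (Function.update w 0 (b (σ i))) c (b j)) = Y at *
    have T := S.smul_mem (-q)⁻¹ (S.sub_mem (S.sub_mem K1 K2)
      (S.smul_mem (q + -(2 : K)⁻¹ * q) K3))
    convert T using 1
    rw [eq_inv_smul_iff₀ (neg_ne_zero.2 e0)]
    module

theorem aux_dual {K V : Type} [Field K] [AddCommGroup V] [Module K V]
    [FiniteDimensional K V] (h2 : (2 : K) ≠ 0)
    (B : LinearMap.BilinForm K V) (hs : ∀ x y, B x y = B y x) (hB : B.Nondegenerate)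
    (W : Submodule K V) (hW : IsotropicSub B W) (m : ℕ) (hm : Module.finrank K W = m) :
    ∃ e f : Fin m → V, (∀ i j, B (e i) (e j) = 0) ∧ (∀ i j, B (f i) (f j) = 0) ∧
      (∀ i j, B (e i) (f j) = if i = j then 1 else 0) := by
  classical
  let bW := Module.finBasisOfFinrankEq K W hm
  have hex : ∀ j, ∃ v : V, ∀ i, B v (bW i) = if i = j then 1 else 0 := by
    intro j
    obtain ⟨φ, hφ⟩ := LinearMap.exists_extend (bW.coord j)
    refine ⟨(B.toDual hB).symm φ, fun i => ?_⟩
    rw [← LinearMap.BilinForm.toDual_def hB, LinearEquiv.apply_symm_apply]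
    have := LinearMap.congr_fun hφ (bW i)
    simp only [LinearMap.comp_apply, Submodule.subtype_apply] at this
    rw [this]
    simp [Finsupp.single_apply]
  choose f' hf' using hex
  have he : ∀ i j, B (bW i : V) (bW j) = 0 := fun i j => hW _ (bW i).2 _ (bW j).2
  have hf'' : ∀ i j, B (bW i : V) (f' j) = if i = j then 1 else 0 := fun i j => by
    rw [hs]; exact hf' j i
  refine ⟨fun i => bW i, fun j => f' j - (2 : K)⁻¹ • ∑ i, B (f' i) (f' j) • (bW i : V),
    he, fun i j => ?_, fun i j => ?_⟩
  · simp [he, hf', hf'']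
    rw [hs (f' j) (f' i)]
    field_simp
    ring
  · simp [he, hf'']

theorem aux_basis {K V : Type} [Field K] [AddCommGroup V] [Module K V]
    [FiniteDimensional K V] (h2 : (2 : K) ≠ 0)
    (B : LinearMap.BilinForm K V) (hs : ∀ x y, B x y = B y x) (hB : B.Nondegenerate)
    (hWitt : MaxWittIndex B) :
    ∃ (ι : Type) (_ : Fintype ι) (σ : ι → ι) (b : ι → V), (∀ i, σ (σ i) = i) ∧
    (∀ i j, σ i = i → σ j = j → i = j) ∧
    (∀ i j, j ≠ σ i → B (b i) (b j) = 0) ∧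
    (∀ i, σ i ≠ i → B (b i) (b (σ i)) = 1) ∧
    (∀ i, σ i = i → B (b i) (b i) ≠ 0) ∧
    Submodule.span K (Set.range b) = ⊤ := by
  classical
  obtain ⟨W, hW, hm⟩ := hWitt
  obtain ⟨m, hmdef⟩ : ∃ m, m = Module.finrank K V / 2 := ⟨_, rfl⟩
  rw [← hmdef] at hm
  obtain ⟨e, f, hee, hff, hef⟩ := aux_dual h2 B hs hB W hW m hm
  have hfe : ∀ i j, B (f i) (e j) = if i = j then 1 else 0 := fun i j => by
    rw [hs, hef]; simp [eq_comm]
  let h : Fin m ⊕ Fin m → V := Sum.elim e f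
  let T : V →ₗ[K] (Fin m ⊕ Fin m → K) := LinearMap.pi (fun i => B (h i))
  have hT : Function.Surjective T := by
    intro y
    refine ⟨∑ i, y (Sum.inl i) • f i + ∑ i, y (Sum.inr i) • e i, ?_⟩
    ext i
    rcases i with i | i <;> simp [T, h, hee, hff, hef, hfe]
  let U := LinearMap.ker T
  have hU : Module.finrank K U ≤ 1 := by
    have h1 := LinearMap.finrank_range_add_finrank_ker T
    rw [LinearMap.range_eq_top.2 hT] at h1
    simp at h1
    change _ + Module.finrank K U = _ at h1
    omega
  let g := Module.finBasis K U
  have hsub : ∀ i j : Fin (Module.finrank K U), i = j := fun i j => by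
    apply Fin.ext; omega
  have hg : ∀ i (x : U), B (h i) x = 0 := fun i x => by
    have := x.2
    exact congrFun (LinearMap.mem_ker.1 this) i
  have hge : ∀ i (x : U), B (e i) x = 0 := fun i x => hg (Sum.inl i) x
  have hgf : ∀ i (x : U), B (f i) x = 0 := fun i x => hg (Sum.inr i) x
  have hge' : ∀ i (x : U), B x (e i) = 0 := fun i x => by rw [hs]; exact hge i x
  have hgf' : ∀ i (x : U), B x (f i) = 0 := fun i x => by rw [hs]; exact hgf i x
  let b : (Fin m ⊕ Fin m) ⊕ Fin (Module.finrank K U) → V := Sum.elim h (fun t => (g t : V))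
  have hspan : Submodule.span K (Set.range b) = ⊤ := by
    rw [eq_top_iff]
    intro v _
    have hbm : ∀ i, b i ∈ Submodule.span K (Set.range b) := fun i =>
      Submodule.subset_span ⟨i, rfl⟩
    obtain ⟨p, hp⟩ : ∃ p, p = ∑ i, B (f i) v • e i + ∑ i, B (e i) v • f i := ⟨_, rfl⟩
    have hpm : p ∈ Submodule.span K (Set.range b) := by
      rw [hp]
      apply Submodule.add_mem
      · exact Submodule.sum_mem _ fun i _ => Submodule.smul_mem _ _ (hbm (Sum.inl (Sum.inl i)))
      · exact Submodule.sum_mem _ fun i _ => Submodule.smul_mem _ _ (hbm (Sum.inl (Sum.inr i)))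
    have hvp : v - p ∈ U := by
      rw [LinearMap.mem_ker]
      ext i
      rcases i with i | i <;> simp [T, h, hp, hee, hff, hef, hfe]
    have hr := congrArg (Subtype.val) (g.sum_repr ⟨v - p, hvp⟩)
    have : v = p + ∑ t, g.repr ⟨v - p, hvp⟩ t • (g t : V) := by
      have : ∑ t, g.repr ⟨v - p, hvp⟩ t • (g t : V) = v - p := by
        simpa only [Submodule.coe_sum, Submodule.coe_smul] using hr
      rw [this]; abel
    rw [this]
    exact Submodule.add_mem _ hpm
      (Submodule.sum_mem _ fun i _ => Submodule.smul_mem _ _ (hbm (Sum.inr i)))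
  refine ⟨(Fin m ⊕ Fin m) ⊕ Fin (Module.finrank K U), inferInstance,
    Sum.map Sum.swap id, b, ?_, ?_, ?_, ?_, ?_, hspan⟩
  · rintro ((i | i) | i) <;> simp
  · rintro ((i | i) | i) ((j | j) | j) <;> simp
    exact hsub i j
  · rintro ((i | i) | i) ((j | j) | j) <;>
      simp +contextual [b, h, hee, hff, hef, hfe, hge, hgf, hge', hgf']
    · exact fun h1 h2 => h1 h2.symm
    · exact fun h1 h2 => h1 h2.symm
    · exact fun h1 => absurd (hsub j i) h1
  · rintro ((i | i) | i) <;> simp [b, h, hef, hfe]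
  · rintro ((i | i) | i) <;> simp
    intro h0
    have : B (g i : V) = 0 := by
      have hle : (⊤ : Submodule K V) ≤ LinearMap.ker (B (g i : V)) := by
        rw [← hspan, Submodule.span_le]
        rintro _ ⟨((j | j) | j), rfl⟩
        · simp [b, h, hge']
        · simp [b, h, hgf']
        · rw [hsub j i]; simpa [b] using h0
      ext x
      simpa using hle (Submodule.mem_top : x ∈ ⊤)
    have h3 : (g i : V) = 0 := hB.1 _ (fun y => by rw [this]; rfl)
    exact g.ne_zero i (Subtype.ext h3)

theorem isotropic_wedges_span (K V : Type) [Field K] [AddCommGroup V] [Module K V]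
    [FiniteDimensional K V] (h2 : (2 : K) ≠ 0)
    (B : LinearMap.BilinForm K V) (hsymm : B.IsSymm) (hB : B.Nondegenerate)
    (hWitt : MaxWittIndex B)
    (n : ℕ) (hkd : n + 1 < Module.finrank K V) :
    Submodule.span K {x : ExteriorAlgebra K V |
      ∃ w : Fin (n + 1) → V, w 0 ≠ 0 ∧ B (w 0) (w 0) = 0 ∧ (∀ j, B (w 0) (w j) = 0) ∧
        x = ExteriorAlgebra.ιMulti K (n + 1) w} = ⋀[K]^(n+1) V := by
  classical
  rw [← ExteriorAlgebra.ιMulti_span_fixedDegree]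
  apply le_antisymm
  · apply Submodule.span_mono
    rintro _ ⟨w, _, _, _, rfl⟩
    exact ⟨w, rfl⟩
  obtain ⟨ι, _, σ, b, hσ, hfix, hb, hb1, hb0, hspan⟩ :=
    aux_basis h2 B hsymm.eq hB hWitt
  rw [Submodule.span_le]
  rintro _ ⟨w, rfl⟩
  have hc : ∀ a, ∃ c : ι → K, ∑ i, c i • b i = w a := fun a =>
    (Submodule.mem_span_range_iff_exists_fun K).1 (hspan ▸ Submodule.mem_top)
  choose c hc using hc
  have hw : w = fun a => ∑ i, c a i • b i := funext fun a => (hc a).symm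
  rw [hw]
  have hsum := MultilinearMap.map_sum
    (ExteriorAlgebra.ιMulti K (n + 1) : V [⋀^Fin (n+1)]→ₗ[K] _).toMultilinearMap
    (fun a i => c a i • b i)
  simp only [AlternatingMap.coe_multilinearMap] at hsum
  rw [SetLike.mem_coe, hsum]
  refine Submodule.sum_mem _ fun u _ => ?_
  have hsm := MultilinearMap.map_smul_univ
    (ExteriorAlgebra.ιMulti K (n + 1) : V [⋀^Fin (n+1)]→ₗ[K] _).toMultilinearMap
    (fun a => c a (u a)) (fun a => b (u a))
  simp only [AlternatingMap.coe_multilinearMap] at hsm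
  rw [hsm]
  apply Submodule.smul_mem
  by_cases hu : Function.Injective u
  · refine aux_core h2 B hsymm.eq n _ ?_ σ hσ hfix b hb hb1 hb0 u hu ?_
    · exact fun w h0 h1 h2 => Submodule.subset_span ⟨w, h0, h1, h2, rfl⟩
    intro hsur
    have h1 := finrank_le_of_span_eq_top hspan
    have h3 := Fintype.card_le_of_surjective u hsur
    simp at h3
    omega
  · rw [AlternatingMap.map_eq_zero_of_not_injective]
    · exact Submodule.zero_mem _
    · intro h
      exact hu (fun x y hxy => h (by simp [hxy]))
end

section
/- Let V be a quadratic space of maximal Witt index over a field of characteristic ≠ 2, and let 0 < k < dim V. If ω ∈ Λ^k V satisfies Φ_v(ω) = 0 for every nonzero isotropic vector v ∈ V, then ω = 0. -/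
open ExteriorAlgebra

section Helpers

variable {K V : Type} [Field K] [AddCommGroup V] [Module K V]

/-- Contraction of the exterior algebra. -/
noncomputable abbrev ctr (d : Module.Dual K V) : ExteriorAlgebra K V →ₗ[K] ExteriorAlgebra K V :=
  CliffordAlgebra.contractLeft (Q := (0 : QuadraticForm K V)) d

lemma ctr_mul (d : Module.Dual K V) (a : V) (x : ExteriorAlgebra K V) :
    ctr d (ι K a * x) = d a • x - ι K a * ctr d x :=
  CliffordAlgebra.contractLeft_ι_mul (Q := (0 : QuadraticForm K V)) (d := d) a x

lemma ind_left {P : ExteriorAlgebra K V → Prop}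
    (h1 : ∀ r : K, P (algebraMap K _ r)) (h2 : ∀ x y, P x → P y → P (x + y))
    (h3 : ∀ (a : V) (x), P x → P (ι K a * x)) (x : ExteriorAlgebra K V) : P x :=
  CliffordAlgebra.left_induction (Q := (0 : QuadraticForm K V)) h1 h2 (fun x m hx => h3 m x hx) x

lemma swap_mul (a b : V) (x : ExteriorAlgebra K V) :
    ι K a * (ι K b * x) = - (ι K b * (ι K a * x)) := by
  rw [← mul_assoc, ← mul_assoc, eq_neg_iff_add_eq_zero, ← add_mul, ι_add_mul_swap, zero_mul]

lemma sq_mul (a : V) (x : ExteriorAlgebra K V) : ι K a * (ι K a * x) = 0 := by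
  rw [← mul_assoc, ι_sq_zero, zero_mul]

lemma wedge_map_congr {U : Type} [AddCommGroup U] [Module K U]
    (v : V) (f g : U →ₗ[K] V) (l : U → K) (hfg : ∀ x, f x = g x + l x • v)
    (z : ExteriorAlgebra K U) :
    ι K v * ExteriorAlgebra.map f z = ι K v * ExteriorAlgebra.map g z := by
  induction z using ind_left with
  | h1 r => simp
  | h2 x y hx hy => simp only [map_add, mul_add, hx, hy]
  | h3 a x hx =>
    simp only [map_mul, map_apply_ι]
    rw [swap_mul, hx, ← swap_mul, hfg]
    simp [add_mul, mul_add, sq_mul]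

lemma map_rho (d : Module.Dual K V) (u : V) (ρ : V →ₗ[K] V) (hρ : ∀ x, ρ x = x - d x • u)
    (z : ExteriorAlgebra K V) :
    ExteriorAlgebra.map ρ z = z - ι K u * ctr d z := by
  induction z using ind_left with
  | h1 r => simp [CliffordAlgebra.contractLeft_algebraMap]
  | h2 x y hx hy => simp only [map_add, mul_add, hx, hy]; abel
  | h3 a x hx =>
    simp only [map_mul, map_apply_ι]
    rw [hx, hρ, ctr_mul, map_sub, map_smul, sub_mul, mul_sub, mul_sub, mul_sub, swap_mul a u,
      smul_mul_assoc, smul_mul_assoc, sq_mul, mul_smul_comm]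
    simp only [smul_zero]
    abel

lemma wedge_ctr_zero (B : LinearMap.BilinForm K V) (hB : B.Nondegenerate)
    (ω : ExteriorAlgebra K V) (v : V)
    (h : v ≠ 0 → B v v = 0 →
      ∀ π : V →ₗ[K] Qt B v, ExtendsProj B v π → Phi B v π ω = 0) (hv : B v v = 0) :
    ι K v * ctr (B v) ω = 0 := by
  by_cases hv0 : v = 0
  · simp [hv0]
  obtain ⟨u0, hu0⟩ : ∃ u, B v u ≠ 0 := by
    by_contra! hc
    exact hv0 (hB.1 v hc)
  set u := (B v u0)⁻¹ • u0 with hu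
  have hu1 : B v u = 1 := by simp [hu, hu0]
  let ρ0 : V →ₗ[K] V := LinearMap.id - (B v).smulRight u
  have hρ0 : ∀ x, ρ0 x = x - B v x • u := fun x => by simp [ρ0]
  let ρ : V →ₗ[K] perpV B v := ρ0.codRestrict _ (fun x => by
    simp [perpV, hρ0, hu1])
  let π : V →ₗ[K] Qt B v := projQ B v ∘ₗ ρ
  have hπ : ExtendsProj B v π := by
    intro x
    have : ρ x.val = x := by
      apply Subtype.ext
      have h1 : B v x.val = 0 := x.2
      change ρ0 x.val = x.val
      rw [hρ0, h1, zero_smul, sub_zero]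
    simp [π, this]
  have h0 := h hv0 hv π hπ
  obtain ⟨s, hs⟩ := (projQ B v).exists_rightInverse_of_surjective
    (LinearMap.range_eq_top.2 (Submodule.mkQ_surjective _))
  have hs' : ∀ x, projQ B v (s x) = x := fun x => by
    simpa using LinearMap.congr_fun hs x
  let τ : V →ₗ[K] V := (perpV B v).subtype ∘ₗ s ∘ₗ π
  have hτ : ∀ x, ∃ c : K, τ x = ρ0 x + c • v := by
    intro x
    have h1 : projQ B v (s (π x) - ρ x) = 0 := by
      rw [map_sub, hs']; simp [π]
    have h2 : s (π x) - ρ x ∈ lineIn B v := by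
      exact (Submodule.Quotient.mk_eq_zero _).1 h1
    obtain ⟨c, hc⟩ := Submodule.mem_span_singleton.1 (Submodule.mem_comap.1 h2)
    refine ⟨c, ?_⟩
    rw [hc]
    change (s (π x) : V) = ρ0 x + ((s (π x) : V) - ρ0 x)
    abel
  choose l hl using hτ
  have h3 := wedge_map_congr v τ ρ0 l hl (ctr (B v) ω)
  rw [map_rho (B v) u ρ0 hρ0] at h3
  have h4 : ctr (B v) (ctr (B v) ω) = 0 := CliffordAlgebra.contractLeft_contractLeft _ _
  have h5 : ExteriorAlgebra.map τ (ctr (B v) ω) = 0 := by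
    have : ExteriorAlgebra.map τ =
      (ExteriorAlgebra.map ((perpV B v).subtype ∘ₗ s)).comp (ExteriorAlgebra.map π) := by
      rw [ExteriorAlgebra.map_comp_map]; rfl
    rw [this, AlgHom.comp_apply]
    have h6 : ExteriorAlgebra.map π (ctr (B v) ω) = 0 := h0
    rw [h6, map_zero]
  rw [h5, h4] at h3
  simpa using h3.symm

/-- `v ∧ i_v`. -/
noncomputable def qop (B : LinearMap.BilinForm K V) (v : V) :
    ExteriorAlgebra K V →ₗ[K] ExteriorAlgebra K V :=
  LinearMap.mulLeft K (ι K v) ∘ₗ ctr (B v)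

lemma qop_apply (B : LinearMap.BilinForm K V) (v : V) (x) :
    qop B v x = ι K v * ctr (B v) x := rfl

lemma qop_add (B : LinearMap.BilinForm K V) (h2 : (2 : K) ≠ 0) (v w : V) (x)
    (h1 : qop B (v + w) x = 0) (h3 : qop B (v - w) x = 0) : qop B v x + qop B w x = 0 := by
  have : (2 : K) • (qop B v x + qop B w x) = qop B (v + w) x + qop B (v - w) x := by
    simp only [qop_apply, map_add, map_sub, LinearMap.add_apply, LinearMap.sub_apply, add_mul,
      sub_mul, mul_add, mul_sub, two_smul]
    abel
  rw [h1, h3, add_zero] at this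
  exact (smul_eq_zero.1 this).resolve_left h2

lemma qop_prod {I : Type} [DecidableEq I] (B : LinearMap.BilinForm K V) (b : I → V)
    (hb : ∀ i j, i ≠ j → B (b i) (b j) = 0) (i : I) (l : List I) :
    qop B (b i) (l.map (fun j => ι K (b j))).prod =
      ((l.count i : K) * B (b i) (b i)) • (l.map (fun j => ι K (b j))).prod := by
  induction l with
  | nil => simp [qop_apply, CliffordAlgebra.contractLeft_one]
  | cons a l ih =>
    simp only [List.map_cons, List.prod_cons]
    rw [qop_apply] at ih ⊢
    rw [ctr_mul, mul_sub, swap_mul, ih, mul_smul_comm, mul_smul_comm, sub_neg_eq_add]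
    by_cases h : a = i
    · subst h
      rw [List.count_cons_self, ← add_smul]
      push_cast
      ring_nf
    · rw [hb i a (Ne.symm h), List.count_cons_of_ne h]
      simp

lemma qop_family {n k : ℕ} (B : LinearMap.BilinForm K V) (b : Fin n → V)
    (hb : ∀ i j, i ≠ j → B (b i) (b j) = 0) (i : Fin n) (s : Set.powersetCard (Fin n) k) :
    qop B (b i) (ExteriorAlgebra.ιMulti_family K k b s) =
      ((if i ∈ s.val then 1 else 0) * B (b i) (b i)) • ExteriorAlgebra.ιMulti_family K k b s := by
  have h1 : ExteriorAlgebra.ιMulti_family K k b s =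
      ((List.ofFn (Set.powersetCard.ofFinEmbEquiv.symm s)).map (fun j => ι K (b j))).prod := by
    rw [ExteriorAlgebra.ιMulti_family, ιMulti_apply, List.map_ofFn]
    rfl
  rw [h1, qop_prod B b hb]
  congr 2
  have hnd : (List.ofFn (Set.powersetCard.ofFinEmbEquiv.symm s)).Nodup :=
    List.nodup_ofFn.2 (Set.powersetCard.ofFinEmbEquiv.symm s).injective
  have hm : i ∈ List.ofFn (Set.powersetCard.ofFinEmbEquiv.symm s) ↔ i ∈ s.val := by
    rw [List.mem_ofFn]
    exact Set.powersetCard.mem_range_ofFinEmbEquiv_symm_iff_mem s i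
  by_cases h : i ∈ s.val
  · rw [List.count_eq_one_of_mem hnd (hm.2 h)]; simp [h]
  · rw [List.count_eq_zero_of_not_mem (fun h' => h (hm.1 h'))]; simp [h]

lemma final_step {n k : ℕ} (B : LinearMap.BilinForm K V) (b : Module.Basis (Fin n) K V)
    (hb : ∀ i j, i ≠ j → B (b i) (b j) = 0) (d : K) (hd : d ≠ 0)
    (hbb : ∀ i, B (b i) (b i) = d ∨ B (b i) (b i) = -d)
    (i0 j0 : Fin n) (hi0 : B (b i0) (b i0) = d) (hj0 : B (b j0) (b j0) = -d)
    (hk : 0 < k) (hkn : k < n) (ω : ExteriorAlgebra K V) (hω : ω ∈ ⋀[K]^k V)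
    (h : ∀ i j, B (b i) (b i) = d → B (b j) (b j) = -d → qop B (b i) ω + qop B (b j) ω = 0) :
    ω = 0 := by
  set e := b.exteriorPower k
  set w := e.repr ⟨ω, hω⟩
  have hω' : ω = ∑ s, w s • ExteriorAlgebra.ιMulti_family K k b s := by
    have := congrArg Subtype.val (e.sum_repr ⟨ω, hω⟩)
    simp only [e, exteriorPower.coe_basis] at this
    rw [← this]
    simp [w, e]
  have hli : LinearIndependent K (ExteriorAlgebra.ιMulti_family K k b) := by
    have := (exteriorPower.ιMulti_family_linearIndependent_ofBasis K k b).map'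
      (⋀[K]^k V).subtype (Submodule.ker_subtype _)
    exact this
  have key : ∀ s, ∀ i j, B (b i) (b i) = d → B (b j) (b j) = -d → w s ≠ 0 →
      (i ∈ s.val ↔ j ∈ s.val) := by
    intro s i j hi hj hws
    have h1 := h i j hi hj
    rw [hω', map_sum, map_sum, ← Finset.sum_add_distrib] at h1
    simp only [map_smul, qop_family B b hb, smul_smul, ← add_smul] at h1
    have h2 := Fintype.linearIndependent_iff.1 hli _ h1 s
    rw [hi, hj, ← mul_add] at h2
    have h3 := (mul_eq_zero.1 h2).resolve_left hws
    by_cases h4 : i ∈ s.val <;> by_cases h5 : j ∈ s.val <;> simp_all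
  have hw : ∀ s, w s = 0 := by
    intro s
    by_contra hws
    have hall : ∀ i, i ∈ s.val ↔ i0 ∈ s.val := by
      intro i
      rcases hbb i with hi | hi
      · rw [key s i j0 hi hj0 hws, key s i0 j0 hi0 hj0 hws]
      · rw [key s i0 i hi0 hi hws]
    have hc : s.val.card = k := s.2
    by_cases h0 : i0 ∈ s.val
    · have : s.val = Finset.univ := by ext i; simp [hall, h0]
      rw [this] at hc; simp at hc; omega
    · have : s.val = ∅ := by ext i; simp [hall, h0]
      rw [this] at hc; simp at hc; omega
  rw [hω']
  simp [hw]

lemma dual_family [FiniteDimensional K V] (h2 : (2 : K) ≠ 0)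
    (B : LinearMap.BilinForm K V) (hsymm : B.IsSymm) (hB : B.Nondegenerate)
    (W : Submodule K V) (hW : IsotropicSub B W) {m : ℕ} (hm : Module.finrank K W = m) :
    ∃ e f : Fin m → V, (∀ i j, B (e i) (e j) = 0) ∧ (∀ i j, B (f i) (f j) = 0) ∧
      (∀ i j, B (e i) (f j) = if i = j then 1 else 0) := by
  let bW : Module.Basis (Fin m) K W := Module.finBasisOfFinrankEq K W hm
  have hf : ∀ j, ∃ f : V, ∀ i, B (bW i : V) f = if i = j then 1 else 0 := by
    intro j
    obtain ⟨g, hg⟩ := LinearMap.exists_extend (bW.coord j)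
    refine ⟨(B.toDual hB).symm g, fun i => ?_⟩
    rw [hsymm.eq, LinearMap.BilinForm.apply_toDual_symm_apply]
    have := LinearMap.congr_fun hg (bW i)
    simp at this
    rw [this]
    simp [Finsupp.single_apply]
  choose f' hf' using hf
  have hee : ∀ i j, B (bW i : V) (bW j : V) = 0 := fun i j => hW _ (bW i).2 _ (bW j).2
  have hf'' : ∀ j i, B (f' j) (bW i : V) = if i = j then 1 else 0 := by
    intro j i; rw [hsymm.eq, hf']
  refine ⟨fun i => bW i, fun j => f' j - ∑ l, ((2 : K)⁻¹ * B (f' j) (f' l)) • (bW l : V),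
    hee, ?_, ?_⟩
  · intro i j
    simp only [map_sub, map_sum, LinearMap.sub_apply, map_smul, LinearMap.sum_apply,
      LinearMap.smul_apply, hf', hf'', hee, smul_eq_mul]
    simp
    rw [hsymm.eq (f' j) (f' i)]
    field_simp
    ring
  · intro i j
    simp only [map_sub, map_sum, map_smul, hf', hee, smul_eq_mul]
    simp

lemma orth_step {I : Type} [Fintype I] (B : LinearMap.BilinForm K V) (h2 : (2 : K) ≠ 0)
    (hsymm : B.IsSymm) (v : I → V) (hcard : Fintype.card I = Module.finrank K V)
    (hb : ∀ i j, i ≠ j → B (v i) (v j) = 0) (d : K) (hd : d ≠ 0)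
    (hbb : ∀ i, B (v i) (v i) = d ∨ B (v i) (v i) = -d)
    (i0 j0 : I) (hi0 : B (v i0) (v i0) = d) (hj0 : B (v j0) (v j0) = -d)
    {k : ℕ} (hk : 0 < k) (hkn : k < Module.finrank K V)
    (ω : ExteriorAlgebra K V) (hω : ω ∈ ⋀[K]^k V)
    (h : ∀ v, B v v = 0 → qop B v ω = 0) :
    ω = 0 := by
  haveI : Nonempty I := ⟨i0⟩
  have hli : LinearIndependent K v := by
    refine LinearMap.BilinForm.linearIndependent_of_iIsOrtho (B := B) (v := v) ?_ ?_
    · intro i j hij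
      exact hb i j hij
    · intro i hi
      have hi' : B (v i) (v i) = 0 := hi
      rcases hbb i with h' | h' <;> rw [hi'] at h'
      · exact hd h'.symm
      · exact hd (neg_eq_zero.1 h'.symm)
  let b0 := basisOfLinearIndependentOfCardEqFinrank hli hcard
  let eq := Fintype.equivFin I
  let b := b0.reindex eq
  have hbv : ∀ i, b i = v (eq.symm i) := fun i => by simp [b, b0]
  refine final_step B b ?_ d hd ?_ (eq i0) (eq j0) ?_ ?_ hk (hcard ▸ hkn) ω hω ?_
  · intro i j hij
    rw [hbv, hbv]
    exact hb _ _ (fun h' => hij (eq.symm.injective h'))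
  · intro i
    rw [hbv]; exact hbb _
  · simpa [hbv] using hi0
  · simpa [hbv] using hj0
  · intro i j hi hj
    have hij : i ≠ j := by
      rintro rfl
      rw [hi] at hj
      have : (2 : K) * d = 0 := by linear_combination hj
      exact (mul_ne_zero h2 hd) this
    have h0 : B (b i) (b j) = 0 := by
      rw [hbv, hbv]; exact hb _ _ (fun h' => hij (eq.symm.injective h'))
    have h0' : B (b j) (b i) = 0 := by rw [hsymm.eq, h0]
    apply qop_add B h2
    · apply h; simp [hi, hj, h0, h0']
    · apply h; simp [hi, hj, h0, h0']

lemma exists_g [FiniteDimensional K V]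
    (B : LinearMap.BilinForm K V) (hsymm : B.IsSymm) (hB : B.Nondegenerate) {m : ℕ}
    (hm : Module.finrank K V = 2 * m + 1) (e f : Fin m → V)
    (hee : ∀ i j, B (e i) (e j) = 0) (hff : ∀ i j, B (f i) (f j) = 0)
    (hef : ∀ i j, B (e i) (f j) = if i = j then 1 else 0) :
    ∃ g : V, (∀ i, B (e i) g = 0) ∧ (∀ i, B (f i) g = 0) ∧ B g g ≠ 0 := by
  have hfe : ∀ i j, B (f i) (e j) = if i = j then 1 else 0 := by
    intro i j; rw [hsymm.eq, hef]; simp [eq_comm]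
  let F : V →ₗ[K] (Fin m → K) × (Fin m → K) :=
    (LinearMap.pi fun i => B (e i)).prod (LinearMap.pi fun i => B (f i))
  have hF : Function.Surjective F := by
    rintro ⟨a, b⟩
    refine ⟨∑ i, a i • f i + ∑ i, b i • e i, ?_⟩
    ext i <;> simp [F, hee, hff, hef, hfe]
  have hker : Module.finrank K (LinearMap.ker F) = 1 := by
    have := LinearMap.finrank_range_add_finrank_ker F
    rw [LinearMap.range_eq_top.2 hF] at this
    simp at this
    omega
  obtain ⟨g, hg0, hg⟩ := finrank_eq_one_iff'.1 hker
  have hgF : F g.val = 0 := g.2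
  have hge : ∀ i, B (e i) g.val = 0 := fun i => congrFun (congrArg Prod.fst hgF) i
  have hgf : ∀ i, B (f i) g.val = 0 := fun i => congrFun (congrArg Prod.snd hgF) i
  refine ⟨g, hge, hgf, fun hgg => hg0 ?_⟩
  apply Subtype.ext
  apply hB.1
  intro x
  let T := ∑ i, B (e i) x • f i + ∑ i, B (f i) x • e i
  have hT : x - T ∈ LinearMap.ker F := by
    rw [LinearMap.mem_ker]
    ext i <;> simp [F, T, hee, hff, hef, hfe]
  obtain ⟨c, hc⟩ := hg ⟨x - T, hT⟩
  have hc' : c • g.val = x - T := congrArg Subtype.val hc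
  have hge' : ∀ i, B g.val (e i) = 0 := fun i => by rw [hsymm.eq, hge]
  have hgf' : ∀ i, B g.val (f i) = 0 := fun i => by rw [hsymm.eq, hgf]
  have : x = c • g.val + T := by rw [hc']; abel
  rw [this]
  simp [T, hgg, hge', hgf']

/-- The orthogonal vectors coming from hyperbolic pairs. -/
def xy {m : ℕ} (e f : Fin m → V) (c : K) : Fin m ⊕ Fin m → V
  | Sum.inl i => e i + c • f i
  | Sum.inr i => e i - c • f i

lemma xy_orth (B : LinearMap.BilinForm K V) {m : ℕ} (e f : Fin m → V) (c : K)
    (hee : ∀ i j, B (e i) (e j) = 0) (hff : ∀ i j, B (f i) (f j) = 0)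
    (hef : ∀ i j, B (e i) (f j) = if i = j then 1 else 0)
    (hfe : ∀ i j, B (f i) (e j) = if i = j then 1 else 0) :
    (∀ i j, i ≠ j → B (xy e f c i) (xy e f c j) = 0) ∧
    (∀ i, B (xy e f c (Sum.inl i)) (xy e f c (Sum.inl i)) = 2 * c) ∧
    (∀ i, B (xy e f c (Sum.inr i)) (xy e f c (Sum.inr i)) = - (2 * c)) := by
  refine ⟨?_, ?_, ?_⟩
  · rintro (i | i) (j | j) hij
    · have : i ≠ j := fun h => hij (by rw [h])
      simp [xy, hee, hff, hef, hfe, this]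
    · simp [xy, hee, hff, hef, hfe]
    · simp [xy, hee, hff, hef, hfe]
    · have : i ≠ j := fun h => hij (by rw [h])
      simp [xy, hee, hff, hef, hfe, this]
  · intro i
    simp [xy, hee, hff, hef, hfe]; ring
  · intro i
    simp [xy, hee, hff, hef, hfe]; ring

end Helpers

/-- If `0 < k < dim V` and `ω ∈ Λ^k V` satisfies `Φ_v(ω) = 0` for every
nonzero isotropic `v`, then `ω = 0`. -/
theorem eq_zero_of_Phi_eq_zero (K V : Type) [Field K] [AddCommGroup V] [Module K V]
    [FiniteDimensional K V] (h2 : (2 : K) ≠ 0)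
    (B : LinearMap.BilinForm K V) (hsymm : B.IsSymm) (hB : B.Nondegenerate)
    (hWitt : MaxWittIndex B)
    (k : ℕ) (hk : 0 < k) (hkd : k < Module.finrank K V)
    (ω : ExteriorAlgebra K V) (hω : ω ∈ ⋀[K]^k V)
    (h : ∀ v : V, v ≠ 0 → B v v = 0 →
      ∀ π : V →ₗ[K] Qt B v, ExtendsProj B v π → Phi B v π ω = 0) :
    ω = 0 := by
  have hq : ∀ v, B v v = 0 → qop B v ω = 0 := fun v hv =>
    wedge_ctr_zero B hB ω v (h v) hv
  obtain ⟨W, hW, hWd⟩ := hWitt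
  obtain ⟨m, hm⟩ : ∃ m, m = Module.finrank K V / 2 := ⟨_, rfl⟩
  rw [← hm] at hWd
  obtain ⟨e, f, hee, hff, hef⟩ := dual_family h2 B hsymm hB W hW hWd
  have hfe : ∀ i j, B (f i) (e j) = if i = j then 1 else 0 := by
    intro i j; rw [hsymm.eq, hef]; simp [eq_comm]
  have hm0 : 0 < m := by omega
  rcases Nat.even_or_odd' (Module.finrank K V) with ⟨m', hn | hn⟩
  · obtain rfl : m = m' := by omega
    obtain ⟨h1, h3, h4⟩ := xy_orth B e f (1 : K) hee hff hef hfe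
    refine orth_step B h2 hsymm (xy e f (1 : K)) (by simp; omega) h1 (2 * 1)
      (by simpa using h2) ?_ (Sum.inl ⟨0, hm0⟩) (Sum.inr ⟨0, hm0⟩) (h3 _) (h4 _) hk hkd ω hω hq
    rintro (i | i)
    · exact Or.inl (h3 i)
    · exact Or.inr (h4 i)
  · obtain rfl : m = m' := by omega
    obtain ⟨g, hge, hgf, hgg⟩ := exists_g B hsymm hB hn e f hee hff hef
    have hge' : ∀ i, B g (e i) = 0 := fun i => by rw [hsymm.eq, hge]
    have hgf' : ∀ i, B g (f i) = 0 := fun i => by rw [hsymm.eq, hgf]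
    have hdd : 2 * ((2 : K)⁻¹ * B g g) = B g g := by field_simp
    obtain ⟨h1, h3, h4⟩ := xy_orth B e f ((2 : K)⁻¹ * B g g) hee hff hef hfe
    rw [hdd] at h3 h4
    have h5 : ∀ i, B g (xy e f ((2 : K)⁻¹ * B g g) i) = 0 := by
      rintro (i | i) <;> simp [xy, hge', hgf']
    refine orth_step B h2 hsymm
      (fun o : Option (Fin m ⊕ Fin m) => o.elim g (xy e f ((2 : K)⁻¹ * B g g)))
      (by simp; omega) ?_ (B g g) hgg ?_
      (some (Sum.inl ⟨0, hm0⟩)) (some (Sum.inr ⟨0, hm0⟩)) (h3 _) (h4 _) hk hkd ω hω hq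
    · rintro (_ | i) (_ | j) hij
      · exact absurd rfl hij
      · exact h5 j
      · exact (hsymm.eq _ _).trans (h5 i)
      · exact h1 i j (fun h => hij (by rw [h]))
    · rintro (_ | i | i)
      · exact Or.inl rfl
      · exact Or.inl (h3 i)
      · exact Or.inr (h4 i)
end

section
/- Let V be an 8-dimensional vector space over K = ℝ or ℂ with hyperbolic basis e_1,…,e_4,e_{-1},…,e_{-4}, and let ω_8 = 2e_1∧e_2∧e_3∧e_4 + 2e_{-1}∧e_{-2}∧e_{-3}∧e_{-4} + Σ_{1≤i<j≤4} e_i∧e_j∧e_{-i}∧e_{-j}. Then the Lie algebra stabilizer 𝔤 = {X ∈ 𝔰𝔬(V) : X·ω_8 = 0} (where X acts on Λ^4 V by derivations) consists exactly of the block matrices (in the basis ordering e_1,…,e_4,e_{-1},…,e_{-4}) of the form [[a, b],[b̃, -aᵀ]] with a ∈ 𝔰𝔩(4,K), b skew-symmetric, and b̃ the skew matrix with entries b̃ = ((0,-b_{34},b_{24},-b_{23}),(b_{34},0,-b_{14},b_{13}),(-b_{24},b_{14},0,-b_{12}),(b_{23},-b_{13},b_{12},0)); in particular dim 𝔤 =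 21. -/
open ExteriorAlgebra Matrix

/-- The standard basis of `K^8`, in the ordering `e₁, e₂, e₃, e₄, e₋₁, e₋₂, e₋₃, e₋₄`. -/
noncomputable def e8 (K : Type) [RCLike K] (i : Fin 8) : Fin 8 → K := Pi.single i 1

/-- The Gram matrix `J = [[0, I₄],[I₄, 0]]` of the hyperbolic form on `K^8`. -/
noncomputable def J8 (K : Type) [RCLike K] : Matrix (Fin 8) (Fin 8) K :=
  (Matrix.fromBlocks 0 1 1 0).submatrix
    ⇑(finSumFinEquiv (m := 4) (n := 4)).symm ⇑(finSumFinEquiv (m := 4) (n := 4)).symm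

/-- The derivation action of a matrix `X` on a pure wedge `w₁ ∧ w₂ ∧ w₃ ∧ w₄`:
`X·(w₁∧w₂∧w₃∧w₄) = Σᵢ w₁ ∧ ⋯ ∧ X wᵢ ∧ ⋯ ∧ w₄`. -/
noncomputable def derivAct (K : Type) [RCLike K] (X : Matrix (Fin 8) (Fin 8) K)
    (w : Fin 4 → (Fin 8 → K)) : ExteriorAlgebra K (Fin 8 → K) :=
  ∑ i : Fin 4, ιMulti K 4 (Function.update w i (X.mulVec (w i)))

/-- The derivation action of `X` on
`ω₈ = 2e₁∧e₂∧e₃∧e₄ + 2e₋₁∧e₋₂∧e₋₃∧e₋₄ + Σ_{1≤i<j≤4} eᵢ∧e_j∧e₋ᵢ∧e₋ⱼ`. -/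
noncomputable def actOmega8 (K : Type) [RCLike K] (X : Matrix (Fin 8) (Fin 8) K) :
    ExteriorAlgebra K (Fin 8 → K) :=
  (2 : K) • derivAct K X ![e8 K 0, e8 K 1, e8 K 2, e8 K 3] +
    (2 : K) • derivAct K X ![e8 K 4, e8 K 5, e8 K 6, e8 K 7] +
    derivAct K X ![e8 K 0, e8 K 1, e8 K 4, e8 K 5] +
    derivAct K X ![e8 K 0, e8 K 2, e8 K 4, e8 K 6] +
    derivAct K X ![e8 K 0, e8 K 3, e8 K 4, e8 K 7] +
    derivAct K X ![e8 K 1, e8 K 2, e8 K 5, e8 K 6] +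
    derivAct K X ![e8 K 1, e8 K 3, e8 K 5, e8 K 7] +
    derivAct K X ![e8 K 2, e8 K 3, e8 K 6, e8 K 7]

/-- For a skew matrix `b`, the associated skew matrix `b̃` (1-indexed:
`b̃ = ((0,-b₃₄,b₂₄,-b₂₃),(b₃₄,0,-b₁₄,b₁₃),(-b₂₄,b₁₄,0,-b₁₂),(b₂₃,-b₁₃,b₁₂,0))`). -/
def btilde (K : Type) [RCLike K] (b : Matrix (Fin 4) (Fin 4) K) : Matrix (Fin 4) (Fin 4) K :=
  !![0, -b 2 3, b 1 3, -b 1 2;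
     b 2 3, 0, -b 0 3, b 0 2;
     -b 1 3, b 0 3, 0, -b 0 1;
     b 1 2, -b 0 2, b 0 1, 0]

/-- The Lie algebra stabilizer `𝔤 = {X ∈ 𝔰𝔬(V) : X·ω₈ = 0}` (as a set of matrices). -/
noncomputable def gSet (K : Type) [RCLike K] : Set (Matrix (Fin 8) (Fin 8) K) :=
  {X | X.trace = 0 ∧ Xᵀ * J8 K + J8 K * X = 0 ∧ actOmega8 K X = 0}

/-- The set of block matrices `[[a, b],[b̃, -aᵀ]]` with `a` traceless and `b` skew. -/
def blockSet (K : Type) [RCLike K] : Set (Matrix (Fin 8) (Fin 8) K) :=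
  {X | ∃ a b : Matrix (Fin 4) (Fin 4) K, a.trace = 0 ∧ bᵀ = -b ∧
    X = (Matrix.fromBlocks a b (btilde K b) (-aᵀ)).submatrix
      ⇑(finSumFinEquiv (m := 4) (n := 4)).symm ⇑(finSumFinEquiv (m := 4) (n := 4)).symm}

/-- Block matrix in `Fin 8` indexing. -/
def blk {K : Type} (a b c d : Matrix (Fin 4) (Fin 4) K) : Matrix (Fin 8) (Fin 8) K :=
  (Matrix.fromBlocks a b c d).submatrix
      ⇑(finSumFinEquiv (m := 4) (n := 4)).symm ⇑(finSumFinEquiv (m := 4) (n := 4)).symm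

theorem blk_surj {K : Type} (X : Matrix (Fin 8) (Fin 8) K) :
    ∃ a b c d, X = blk a b c d := by
  let Y : Matrix (Fin 4 ⊕ Fin 4) (Fin 4 ⊕ Fin 4) K :=
    X.submatrix (finSumFinEquiv (m := 4) (n := 4)) (finSumFinEquiv (m := 4) (n := 4))
  refine ⟨Y.toBlocks₁₁, Y.toBlocks₁₂, Y.toBlocks₂₁, Y.toBlocks₂₂, ?_⟩
  rw [blk, Matrix.fromBlocks_toBlocks]
  ext i j
  simp [Y]

theorem blk_inj {K : Type} {a b c d a' b' c' d' : Matrix (Fin 4) (Fin 4) K}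
    (h : blk a b c d = blk a' b' c' d') : a = a' ∧ b = b' ∧ c = c' ∧ d = d' := by
  rw [← Matrix.fromBlocks_inj]
  ext i j
  have := congrFun (congrFun h (finSumFinEquiv (m := 4) (n := 4) i))
    (finSumFinEquiv (m := 4) (n := 4) j)
  simpa [blk] using this

theorem blk_so (K : Type) [RCLike K] (a b c d : Matrix (Fin 4) (Fin 4) K) :
    (blk a b c d)ᵀ * J8 K + J8 K * blk a b c d = 0 ↔
      cᵀ + c = 0 ∧ aᵀ + d = 0 ∧ dᵀ + a = 0 ∧ bᵀ + b = 0 := by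
  have h0 : (0 : Matrix (Fin 8) (Fin 8) K) = blk 0 0 0 0 := by
    simp [blk]
  have h1 : (blk a b c d)ᵀ * J8 K + J8 K * blk a b c d
      = blk (cᵀ + c) (aᵀ + d) (dᵀ + a) (bᵀ + b) := by
    unfold blk J8
    rw [Matrix.transpose_submatrix, Matrix.submatrix_mul_equiv, Matrix.submatrix_mul_equiv,
      Matrix.fromBlocks_transpose, Matrix.fromBlocks_multiply,
      Matrix.fromBlocks_multiply]
    ext i j
    simp only [Matrix.add_apply, Matrix.submatrix_apply]
    rw [← Matrix.add_apply, Matrix.fromBlocks_add]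
    simp
  rw [h1, h0]
  constructor
  · intro h; exact blk_inj h
  · rintro ⟨h1, h2, h3, h4⟩; rw [h1, h2, h3, h4]

theorem blk_trace (K : Type) [RCLike K] (a b c d : Matrix (Fin 4) (Fin 4) K) :
    (blk a b c d).trace = a.trace + d.trace := by
  have h : (blk a b c d).trace = (Matrix.fromBlocks a b c d).trace :=
    Equiv.sum_comp (finSumFinEquiv (m := 4) (n := 4)).symm
      (fun i => (Matrix.fromBlocks a b c d).diag i)
  rw [h]
  simp [Matrix.trace]

/-- Coordinate functional. -/
noncomputable def coordAlt (K : Type) [RCLike K] (s : Fin 4 → Fin 8) :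
    (Fin 8 → K) [⋀^Fin 4]→ₗ[K] K :=
  (Matrix.detRowAlternating (n := Fin 4) (R := K)).compLinearMap
    (LinearMap.funLeft K K s)

noncomputable def coordFn (K : Type) [RCLike K] (s : Fin 4 → Fin 8) :
    ExteriorAlgebra K (Fin 8 → K) →ₗ[K] K :=
  ExteriorAlgebra.liftAlternating (Function.update 0 4 (coordAlt K s))

theorem coordFn_apply (K : Type) [RCLike K] (s : Fin 4 → Fin 8) (v : Fin 4 → Fin 8 → K) :
    coordFn K s (ιMulti K 4 v) = Matrix.det (Matrix.of fun i j => v i (s j)) := by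
  rw [coordFn, ExteriorAlgebra.liftAlternating_apply_ιMulti]
  simp [coordAlt]
  rfl

/-- Basis vectors in the exterior algebra. -/
noncomputable def E (K : Type) [RCLike K] (i : Fin 8) : ExteriorAlgebra K (Fin 8 → K) :=
  ι K (e8 K i)

theorem E_sq (K : Type) [RCLike K] (i : Fin 8) : E K i * E K i = 0 :=
  ι_sq_zero _

theorem E_sq' (K : Type) [RCLike K] (i : Fin 8) (x : ExteriorAlgebra K (Fin 8 → K)) :
    E K i * (E K i * x) = 0 := by
  rw [← mul_assoc, E_sq, zero_mul]

theorem E_anti (K : Type) [RCLike K] (i j : Fin 8) (_ : j < i) :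
    E K i * E K j = - (E K j * E K i) :=
  eq_neg_of_add_eq_zero_left (ι_add_mul_swap _ _)

theorem E_anti' (K : Type) [RCLike K] (i j : Fin 8) (h : j < i)
    (x : ExteriorAlgebra K (Fin 8 → K)) :
    E K i * (E K j * x) = - (E K j * (E K i * x)) := by
  rw [← mul_assoc, E_anti K i j h, neg_mul, mul_assoc]

theorem ι_mulVec (K : Type) [RCLike K] (X : Matrix (Fin 8) (Fin 8) K) (p : Fin 8) :
    ι K (X.mulVec (e8 K p)) = ∑ k, X k p • E K k := by
  have : X.mulVec (e8 K p) = ∑ k, X k p • e8 K k := by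
    ext i
    simp [e8, Finset.sum_apply, Pi.single_apply]
  rw [this, map_sum]
  simp [E]

theorem derivAct_E (K : Type) [RCLike K] (X : Matrix (Fin 8) (Fin 8) K) (p q r t : Fin 8) :
    derivAct K X ![e8 K p, e8 K q, e8 K r, e8 K t] =
      ∑ k, (X k p • (E K k * (E K q * (E K r * E K t)))
        + X k q • (E K p * (E K k * (E K r * E K t)))
        + X k r • (E K p * (E K q * (E K k * E K t)))
        + X k t • (E K p * (E K q * (E K r * E K k)))) := by
  have key : ∀ w : Fin 4 → Fin 8 → K, ιMulti K 4 w =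
      ι K (w 0) * (ι K (w 1) * (ι K (w 2) * ι K (w 3))) := by
    intro w
    rw [ιMulti_apply]
    simp [List.ofFn_succ]
  simp only [Finset.sum_add_distrib]
  simp only [derivAct, Fin.sum_univ_four, key]
  simp [ι_mulVec, Finset.sum_mul, Finset.mul_sum, ← E.eq_1]

theorem coord_E (K : Type) [RCLike K] (s : Fin 4 → Fin 8) (p q r t : Fin 8) :
    coordFn K s (E K p * (E K q * (E K r * E K t))) =
      Matrix.det (Matrix.of fun i j => if s j = ![p, q, r, t] i then (1:K) else 0) := by
  have h : E K p * (E K q * (E K r * E K t)) =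
      ιMulti K 4 (fun i => e8 K (![p, q, r, t] i)) := by
    rw [ιMulti_apply]
    simp [List.ofFn_succ, E]
  rw [h, coordFn_apply]
  congr 1
  ext i j
  simp [e8, Pi.single_apply]

theorem coord_zero (K : Type) [RCLike K] (s : Fin 4 → Fin 8) (p q r t : Fin 8)
    (h : ∃ i, ∀ j, s j ≠ ![p, q, r, t] i) :
    coordFn K s (E K p * (E K q * (E K r * E K t))) = 0 := by
  obtain ⟨i, hi⟩ := h
  rw [coord_E]
  refine Matrix.det_eq_zero_of_row_eq_zero i fun j => ?_
  simp only [Matrix.of_apply]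
  rw [if_neg (hi j)]

theorem coord_one (K : Type) [RCLike K] (p q r t : Fin 8)
    (h : Function.Injective ![p, q, r, t]) :
    coordFn K ![p, q, r, t] (E K p * (E K q * (E K r * E K t))) = 1 := by
  rw [coord_E]
  convert Matrix.det_one (n := Fin 4) (R := K) using 2
  ext i j
  simp only [Matrix.of_apply, h.eq_iff, Matrix.one_apply, eq_comm]

set_option maxHeartbeats 4000000 in
theorem actOmega8_E (K : Type) [RCLike K] (X : Matrix (Fin 8) (Fin 8) K) :
    actOmega8 K X =
      (2 * X 0 0 + 2 * X 1 1 + 2 * X 2 2 + 2 * X 3 3) • (E K 0 * (E K 1 * (E K 2 * E K 3))) +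
      (2 * X 4 3 - X 2 5 + X 1 6) • (E K 0 * (E K 1 * (E K 2 * E K 4))) +
      (2 * X 5 3 + X 2 4 - X 0 6) • (E K 0 * (E K 1 * (E K 2 * E K 5))) +
      (2 * X 6 3 - X 1 4 + X 0 5) • (E K 0 * (E K 1 * (E K 2 * E K 6))) +
      (2 * X 7 3) • (E K 0 * (E K 1 * (E K 2 * E K 7))) +
      (- 2 * X 4 2 - X 3 5 + X 1 7) • (E K 0 * (E K 1 * (E K 3 * E K 4))) +
      (- 2 * X 5 2 + X 3 4 - X 0 7) • (E K 0 * (E K 1 * (E K 3 * E K 5))) +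
      (- 2 * X 6 2) • (E K 0 * (E K 1 * (E K 3 * E K 6))) +
      (- 2 * X 7 2 - X 1 4 + X 0 5) • (E K 0 * (E K 1 * (E K 3 * E K 7))) +
      (X 0 0 + X 1 1 + X 4 4 + X 5 5) • (E K 0 * (E K 1 * (E K 4 * E K 5))) +
      (X 6 5 + X 1 2) • (E K 0 * (E K 1 * (E K 4 * E K 6))) +
      (X 7 5 + X 1 3) • (E K 0 * (E K 1 * (E K 4 * E K 7))) +
      (- X 6 4 - X 0 2) • (E K 0 * (E K 1 * (E K 5 * E K 6))) +
      (- X 7 4 - X 0 3) • (E K 0 * (E K 1 * (E K 5 * E K 7))) +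
      (2 * X 4 1 - X 3 6 + X 2 7) • (E K 0 * (E K 2 * (E K 3 * E K 4))) +
      (2 * X 5 1) • (E K 0 * (E K 2 * (E K 3 * E K 5))) +
      (2 * X 6 1 + X 3 4 - X 0 7) • (E K 0 * (E K 2 * (E K 3 * E K 6))) +
      (2 * X 7 1 - X 2 4 + X 0 6) • (E K 0 * (E K 2 * (E K 3 * E K 7))) +
      (X 2 1 + X 5 6) • (E K 0 * (E K 2 * (E K 4 * E K 5))) +
      (X 0 0 + X 2 2 + X 4 4 + X 6 6) • (E K 0 * (E K 2 * (E K 4 * E K 6))) +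
      (X 7 6 + X 2 3) • (E K 0 * (E K 2 * (E K 4 * E K 7))) +
      (X 5 4 + X 0 1) • (E K 0 * (E K 2 * (E K 5 * E K 6))) +
      (- X 7 4 - X 0 3) • (E K 0 * (E K 2 * (E K 6 * E K 7))) +
      (X 3 1 + X 5 7) • (E K 0 * (E K 3 * (E K 4 * E K 5))) +
      (X 3 2 + X 6 7) • (E K 0 * (E K 3 * (E K 4 * E K 6))) +
      (X 0 0 + X 3 3 + X 4 4 + X 7 7) • (E K 0 * (E K 3 * (E K 4 * E K 7))) +
      (X 5 4 + X 0 1) • (E K 0 * (E K 3 * (E K 5 * E K 7))) +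
      (X 6 4 + X 0 2) • (E K 0 * (E K 3 * (E K 6 * E K 7))) +
      (- 2 * X 0 7 + X 6 1 - X 5 2) • (E K 0 * (E K 4 * (E K 5 * E K 6))) +
      (2 * X 0 6 + X 7 1 - X 5 3) • (E K 0 * (E K 4 * (E K 5 * E K 7))) +
      (- 2 * X 0 5 + X 7 2 - X 6 3) • (E K 0 * (E K 4 * (E K 6 * E K 7))) +
      (2 * X 0 4) • (E K 0 * (E K 5 * (E K 6 * E K 7))) +
      (- 2 * X 4 0) • (E K 1 * (E K 2 * (E K 3 * E K 4))) +
      (- 2 * X 5 0 - X 3 6 + X 2 7) • (E K 1 * (E K 2 * (E K 3 * E K 5))) +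
      (- 2 * X 6 0 + X 3 5 - X 1 7) • (E K 1 * (E K 2 * (E K 3 * E K 6))) +
      (- 2 * X 7 0 - X 2 5 + X 1 6) • (E K 1 * (E K 2 * (E K 3 * E K 7))) +
      (- X 2 0 - X 4 6) • (E K 1 * (E K 2 * (E K 4 * E K 5))) +
      (X 1 0 + X 4 5) • (E K 1 * (E K 2 * (E K 4 * E K 6))) +
      (X 1 1 + X 2 2 + X 5 5 + X 6 6) • (E K 1 * (E K 2 * (E K 5 * E K 6))) +
      (X 7 6 + X 2 3) • (E K 1 * (E K 2 * (E K 5 * E K 7))) +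
      (- X 7 5 - X 1 3) • (E K 1 * (E K 2 * (E K 6 * E K 7))) +
      (- X 3 0 - X 4 7) • (E K 1 * (E K 3 * (E K 4 * E K 5))) +
      (X 1 0 + X 4 5) • (E K 1 * (E K 3 * (E K 4 * E K 7))) +
      (X 3 2 + X 6 7) • (E K 1 * (E K 3 * (E K 5 * E K 6))) +
      (X 1 1 + X 3 3 + X 5 5 + X 7 7) • (E K 1 * (E K 3 * (E K 5 * E K 7))) +
      (X 6 5 + X 1 2) • (E K 1 * (E K 3 * (E K 6 * E K 7))) +
      (- 2 * X 1 7 - X 6 0 + X 4 2) • (E K 1 * (E K 4 * (E K 5 * E K 6))) +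
      (2 * X 1 6 - X 7 0 + X 4 3) • (E K 1 * (E K 4 * (E K 5 * E K 7))) +
      (- 2 * X 1 5) • (E K 1 * (E K 4 * (E K 6 * E K 7))) +
      (2 * X 1 4 + X 7 2 - X 6 3) • (E K 1 * (E K 5 * (E K 6 * E K 7))) +
      (- X 3 0 - X 4 7) • (E K 2 * (E K 3 * (E K 4 * E K 6))) +
      (X 2 0 + X 4 6) • (E K 2 * (E K 3 * (E K 4 * E K 7))) +
      (- X 3 1 - X 5 7) • (E K 2 * (E K 3 * (E K 5 * E K 6))) +
      (X 2 1 + X 5 6) • (E K 2 * (E K 3 * (E K 5 * E K 7))) +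
      (X 2 2 + X 3 3 + X 6 6 + X 7 7) • (E K 2 * (E K 3 * (E K 6 * E K 7))) +
      (- 2 * X 2 7 + X 5 0 - X 4 1) • (E K 2 * (E K 4 * (E K 5 * E K 6))) +
      (2 * X 2 6) • (E K 2 * (E K 4 * (E K 5 * E K 7))) +
      (- 2 * X 2 5 - X 7 0 + X 4 3) • (E K 2 * (E K 4 * (E K 6 * E K 7))) +
      (2 * X 2 4 - X 7 1 + X 5 3) • (E K 2 * (E K 5 * (E K 6 * E K 7))) +
      (- 2 * X 3 7) • (E K 3 * (E K 4 * (E K 5 * E K 6))) +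
      (2 * X 3 6 + X 5 0 - X 4 1) • (E K 3 * (E K 4 * (E K 5 * E K 7))) +
      (- 2 * X 3 5 + X 6 0 - X 4 2) • (E K 3 * (E K 4 * (E K 6 * E K 7))) +
      (2 * X 3 4 + X 6 1 - X 5 2) • (E K 3 * (E K 5 * (E K 6 * E K 7))) +
      (2 * X 4 4 + 2 * X 5 5 + 2 * X 6 6 + 2 * X 7 7) • (E K 4 * (E K 5 * (E K 6 * E K 7))) := by
  simp only [actOmega8, derivAct_E, Fin.sum_univ_eight]
  simp (disch := decide) only [E_sq, E_sq', E_anti, E_anti', mul_zero, smul_zero, mul_neg, smul_neg, neg_neg, neg_zero, add_zero, zero_add]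
  module

theorem coords (K : Type) [RCLike K] (X : Matrix (Fin 8) (Fin 8) K) (h : actOmega8 K X = 0) :
    2 * X 0 0 + 2 * X 1 1 + 2 * X 2 2 + 2 * X 3 3 = 0 ∧
    2 * X 4 3 - X 2 5 + X 1 6 = 0 ∧
    2 * X 5 3 + X 2 4 - X 0 6 = 0 ∧
    2 * X 6 3 - X 1 4 + X 0 5 = 0 ∧
    - 2 * X 4 2 - X 3 5 + X 1 7 = 0 ∧
    - 2 * X 5 2 + X 3 4 - X 0 7 = 0 ∧
    2 * X 4 1 - X 3 6 + X 2 7 = 0 := by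
  rw [actOmega8_E] at h
  have H := fun s => congrArg (coordFn K s) h
  simp only [map_add, map_smul, map_zero, smul_eq_mul] at H
  refine ⟨?_, ?_, ?_, ?_, ?_, ?_, ?_⟩
  · simpa (disch := decide) only [coord_zero, coord_one, mul_one, add_zero, zero_add,
      mul_zero] using H ![0, 1, 2, 3]
  · simpa (disch := decide) only [coord_zero, coord_one, mul_one, add_zero, zero_add,
      mul_zero] using H ![0, 1, 2, 4]
  · simpa (disch := decide) only [coord_zero, coord_one, mul_one, add_zero, zero_add,
      mul_zero] using H ![0, 1, 2, 5]
  · simpa (disch := decide) only [coord_zero, coord_one, mul_one, add_zero, zero_add,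
      mul_zero] using H ![0, 1, 2, 6]
  · simpa (disch := decide) only [coord_zero, coord_one, mul_one, add_zero, zero_add,
      mul_zero] using H ![0, 1, 3, 4]
  · simpa (disch := decide) only [coord_zero, coord_one, mul_one, add_zero, zero_add,
      mul_zero] using H ![0, 1, 3, 5]
  · simpa (disch := decide) only [coord_zero, coord_one, mul_one, add_zero, zero_add,
      mul_zero] using H ![0, 2, 3, 4]

theorem blk_lit {K : Type} (a b c d : Matrix (Fin 4) (Fin 4) K) :
    blk a b c d = !![a 0 0, a 0 1, a 0 2, a 0 3, b 0 0, b 0 1, b 0 2, b 0 3;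
      a 1 0, a 1 1, a 1 2, a 1 3, b 1 0, b 1 1, b 1 2, b 1 3;
      a 2 0, a 2 1, a 2 2, a 2 3, b 2 0, b 2 1, b 2 2, b 2 3;
      a 3 0, a 3 1, a 3 2, a 3 3, b 3 0, b 3 1, b 3 2, b 3 3;
      c 0 0, c 0 1, c 0 2, c 0 3, d 0 0, d 0 1, d 0 2, d 0 3;
      c 1 0, c 1 1, c 1 2, c 1 3, d 1 0, d 1 1, d 1 2, d 1 3;
      c 2 0, c 2 1, c 2 2, c 2 3, d 2 0, d 2 1, d 2 2, d 2 3;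
      c 3 0, c 3 1, c 3 2, c 3 3, d 3 0, d 3 1, d 3 2, d 3 3] := by
  ext i j
  fin_cases i <;> fin_cases j <;> rfl

theorem skew_entries (K : Type) [RCLike K] {b : Matrix (Fin 4) (Fin 4) K} (hb : bᵀ + b = 0) :
    (∀ i, b i i = 0) ∧ ∀ i j, b j i = - b i j := by
  have h : ∀ i j, b j i = - b i j := fun i j => by
    have := congrFun (congrFun hb i) j
    simp only [Matrix.add_apply, Matrix.transpose_apply, Matrix.zero_apply] at this
    exact eq_neg_of_add_eq_zero_left this
  refine ⟨fun i => ?_, h⟩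
  have := h i i
  linear_combination this / 2

set_option maxHeartbeats 4000000 in
theorem act_zero (K : Type) [RCLike K] (a b : Matrix (Fin 4) (Fin 4) K)
    (ha : a.trace = 0) (hb : bᵀ + b = 0) :
    actOmega8 K (blk a b (btilde K b) (-aᵀ)) = 0 := by
  obtain ⟨h0, h1⟩ := skew_entries K hb
  rw [Matrix.trace, Fin.sum_univ_four] at ha
  simp only [Matrix.diag_apply] at ha
  have ha' : a 3 3 = -(a 0 0 + a 1 1 + a 2 2) := by linear_combination ha
  rw [actOmega8_E, blk_lit]
  simp [btilde, h0, h1 0 1, h1 0 2, h1 0 3, h1 1 2, h1 1 3, h1 2 3, ha']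
  module

set_option maxHeartbeats 4000000 in
theorem act_only (K : Type) [RCLike K] (a b c d : Matrix (Fin 4) (Fin 4) K)
    (hb : bᵀ + b = 0) (hc : cᵀ + c = 0) (h : actOmega8 K (blk a b c d) = 0) :
    a.trace = 0 ∧ c = btilde K b := by
  obtain ⟨h0, h1⟩ := skew_entries K hb
  obtain ⟨k0, k1⟩ := skew_entries K hc
  have H := coords K _ h
  rw [blk_lit] at H
  simp [h1 0 1, h1 0 2, h1 0 3, h1 1 2, h1 1 3, h1 2 3] at H
  obtain ⟨e1, e2, e3, e4, e5, e6, e7⟩ := H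
  have f2 : c 0 3 = - b 1 2 := by linear_combination e2 / 2
  have f3 : c 1 3 = b 0 2 := by linear_combination e3 / 2
  have f4 : c 2 3 = - b 0 1 := by linear_combination e4 / 2
  have f5 : c 0 2 = b 1 3 := by linear_combination - e5 / 2
  have f6 : c 1 2 = - b 0 3 := by linear_combination - e6 / 2
  have f7 : c 0 1 = - b 2 3 := by linear_combination e7 / 2
  constructor
  · rw [Matrix.trace, Fin.sum_univ_four]
    simp only [Matrix.diag_apply]
    linear_combination e1 / 2
  · ext i j
    fin_cases i <;> fin_cases j <;>
      simp [btilde, k0, k1 0 1, k1 0 2, k1 0 3, k1 1 2, k1 1 3, k1 2 3, f2, f3, f4, f5, f6, f7]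

theorem gSet_eq (K : Type) [RCLike K] : gSet K = blockSet K := by
  ext X
  constructor
  · rintro ⟨-, h2, h3⟩
    obtain ⟨a, b, c, d, rfl⟩ := blk_surj X
    obtain ⟨hc, hd, -, hb⟩ := (blk_so K a b c d).1 h2
    obtain ⟨ha, rfl⟩ := act_only K a b c d hb hc h3
    refine ⟨a, b, ha, eq_neg_of_add_eq_zero_left hb, ?_⟩
    rw [← eq_neg_of_add_eq_zero_right hd]
    rfl
  · rintro ⟨a, b, ha, hb, rfl⟩
    have hb' : bᵀ + b = 0 := by rw [hb]; simp
    obtain ⟨h0, h1⟩ := skew_entries K hb'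
    refine ⟨?_, ?_, act_zero K a b ha hb'⟩
    · refine (blk_trace K a b (btilde K b) (-aᵀ)).trans ?_
      simp
    · refine (blk_so K a b (btilde K b) (-aᵀ)).2 ⟨?_, ?_, ?_, hb'⟩
      · ext i j
        fin_cases i <;> fin_cases j <;> simp [btilde]
      · simp
      · simp

/-- Traceless part of the parametrization. -/
def parA {K : Type} [RCLike K] (v : Fin 21 → K) : Matrix (Fin 4) (Fin 4) K :=
  !![v 0, v 1, v 2, v 3; v 4, v 5, v 6, v 7; v 8, v 9, v 10, v 11;
    v 12, v 13, v 14, -(v 0 + v 5 + v 10)]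

/-- Skew part of the parametrization. -/
def parB {K : Type} [RCLike K] (v : Fin 21 → K) : Matrix (Fin 4) (Fin 4) K :=
  !![0, v 15, v 16, v 17; -v 15, 0, v 18, v 19; -v 16, -v 18, 0, v 20;
    -v 17, -v 19, -v 20, 0]

theorem blk_add {K : Type} [RCLike K] (a b c d a' b' c' d' : Matrix (Fin 4) (Fin 4) K) :
    blk a b c d + blk a' b' c' d' = blk (a + a') (b + b') (c + c') (d + d') := by
  rw [blk, blk, blk, ← Matrix.fromBlocks_add]
  rfl

theorem blk_smul {K : Type} [RCLike K] (r : K) (a b c d : Matrix (Fin 4) (Fin 4) K) :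
    r • blk a b c d = blk (r • a) (r • b) (r • c) (r • d) := by
  rw [blk, blk, ← Matrix.fromBlocks_smul]
  rfl

/-- The parametrization of the stabilizer. -/
def par (K : Type) [RCLike K] : (Fin 21 → K) →ₗ[K] Matrix (Fin 8) (Fin 8) K where
  toFun v := blk (parA v) (parB v) (btilde K (parB v)) (-(parA v)ᵀ)
  map_add' v w := by
    have hA : parA (v + w) = parA v + parA w := by
      ext i j
      fin_cases i <;> fin_cases j <;> simp [parA] <;> ring
    have hB : parB (v + w) = parB v + parB w := by
      ext i j
      fin_cases i <;> fin_cases j <;> simp [parB] <;> ring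
    have hC : ∀ b b' : Matrix (Fin 4) (Fin 4) K,
        btilde K (b + b') = btilde K b + btilde K b' := by
      intro b b'
      ext i j
      fin_cases i <;> fin_cases j <;> simp [btilde] <;> ring
    rw [blk_add, hA, hB, hC, Matrix.transpose_add, neg_add]
  map_smul' r v := by
    have hA : parA (r • v) = r • parA v := by
      ext i j
      fin_cases i <;> fin_cases j <;> simp [parA] <;> ring
    have hB : parB (r • v) = r • parB v := by
      ext i j
      fin_cases i <;> fin_cases j <;> simp [parB]
    have hC : ∀ b : Matrix (Fin 4) (Fin 4) K, btilde K (r • b) = r • btilde K b := by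
      intro b
      ext i j
      fin_cases i <;> fin_cases j <;> simp [btilde]
    rw [RingHom.id_apply, blk_smul, hA, hB, hC, Matrix.transpose_smul, smul_neg]

theorem par_inj (K : Type) [RCLike K] : Function.Injective (par K) := by
  intro v w h
  obtain ⟨h1, h2, -, -⟩ := blk_inj h
  have ea := fun i j => congrFun (congrFun h1 i) j
  have eb := fun i j => congrFun (congrFun h2 i) j
  ext i
  fin_cases i
  exacts [ea 0 0, ea 0 1, ea 0 2, ea 0 3, ea 1 0, ea 1 1, ea 1 2, ea 1 3, ea 2 0, ea 2 1,
    ea 2 2, ea 2 3, ea 3 0, ea 3 1, ea 3 2, eb 0 1, eb 0 2, eb 0 3, eb 1 2, eb 1 3, eb 2 3]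

theorem par_range (K : Type) [RCLike K] : blockSet K = (LinearMap.range (par K) : Set _) := by
  ext X
  constructor
  · rintro ⟨a, b, ha, hb, rfl⟩
    have hb' : bᵀ + b = 0 := by rw [hb]; simp
    obtain ⟨h0, h1⟩ := skew_entries K hb'
    rw [Matrix.trace, Fin.sum_univ_four] at ha
    simp only [Matrix.diag_apply] at ha
    have ha' : a 3 3 = -(a 0 0 + a 1 1 + a 2 2) := by linear_combination ha
    let v : Fin 21 → K := ![a 0 0, a 0 1, a 0 2, a 0 3, a 1 0, a 1 1, a 1 2, a 1 3, a 2 0, a 2 1,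
      a 2 2, a 2 3, a 3 0, a 3 1, a 3 2, b 0 1, b 0 2, b 0 3, b 1 2, b 1 3, b 2 3]
    have hA : parA v = a := by
      ext i j
      fin_cases i <;> fin_cases j <;> first | rfl | exact ha'.symm
    have hB : parB v = b := by
      ext i j
      fin_cases i <;> fin_cases j <;> first | rfl | exact (h0 _).symm | exact (h1 _ _).symm
    refine ⟨v, ?_⟩
    change blk (parA v) (parB v) (btilde K (parB v)) (-(parA v)ᵀ) = _
    rw [hA, hB]
    rfl
  · rintro ⟨v, rfl⟩
    refine ⟨parA v, parB v, ?_, ?_, rfl⟩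
    · rw [Matrix.trace, Fin.sum_univ_four]
      simp [parA]
    · ext i j
      fin_cases i <;> fin_cases j <;> simp [parB]

/-- The Lie algebra stabilizer of `ω₈` in `𝔰𝔬(8)` consists exactly of the
block matrices `[[a, b],[b̃, -aᵀ]]` with `a ∈ 𝔰𝔩(4,K)` and `b` skew-symmetric; in
particular it is a subspace of dimension `21`. -/
theorem stabilizer_omega8 (K : Type) [RCLike K] :
    gSet K = blockSet K ∧
    Module.finrank K ↥(Submodule.span K (gSet K)) = 21 := by
  refine ⟨gSet_eq K, ?_⟩
  rw [gSet_eq, par_range, Submodule.span_eq, LinearMap.finrank_range_of_inj (par_inj K)]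
  simp
end

section
/- Let V be a quadratic space of maximal Witt index p = ⌊dim V/2⌋ over a field of characteristic ≠ 2, and decompose V = V' ⊕ span{e_p, e_{-p}} as above. Suppose ω ∈ Ĝr_iso(p,V) is nonzero, written as ω = ω_1 ∧ e_p ∧ e_{-p} + ω_2 ∧ e_p + ω_3 ∧ e_{-p} + ω_4. If dim V is even, then ω_1 = 0 implies at most one of ω_2, ω_3, ω_4 is nonzero; equivalently, the 'zero pattern' (ω_1 = 0, ω_2 ≠ 0, ω_3 ≠ 0, ω_4 ≠ 0) cannot occur when dim V is even. -/
open ExteriorAlgebra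

section Helpers

variable {K V : Type} [Field K] [AddCommGroup V] [Module K V]

/-- Right contraction on the exterior algebra. -/
noncomputable def cR (d : Module.Dual K V) :
    ExteriorAlgebra K V →ₗ[K] ExteriorAlgebra K V :=
  (CliffordAlgebra.contractRight (Q := (0 : QuadraticForm K V))).flip d

theorem cR_mul (d : Module.Dual K V) (x : ExteriorAlgebra K V) (v : V) :
    cR d (x * ExteriorAlgebra.ι K v) = d v • x - cR d x * ExteriorAlgebra.ι K v :=
  CliffordAlgebra.contractRight_mul_ι (Q := (0 : QuadraticForm K V)) d v x

theorem cR_one (d : Module.Dual K V) : cR d (1 : ExteriorAlgebra K V) = 0 :=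
  CliffordAlgebra.contractRight_one (Q := (0 : QuadraticForm K V)) d

theorem ιMulti_snoc' (m : ℕ) (w : Fin (m + 1) → V) :
    ExteriorAlgebra.ιMulti K (m + 1) w =
      ExteriorAlgebra.ιMulti K m (fun i => w i.castSucc) * ExteriorAlgebra.ι K (w (Fin.last m)) := by
  rw [ExteriorAlgebra.ιMulti_apply, ExteriorAlgebra.ιMulti_apply, List.ofFn_succ']
  simp [List.concat_eq_append]

theorem cR_ιMulti (d : Module.Dual K V) (m : ℕ) (w : Fin m → V) (hw : ∀ i, d (w i) = 0) :
    cR d (ExteriorAlgebra.ιMulti K m w) = 0 := by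
  induction m with
  | zero => simp [ExteriorAlgebra.ιMulti_apply, cR_one]
  | succ m ih =>
    rw [ιMulti_snoc', cR_mul, hw, ih _ (fun i => hw _)]
    simp

theorem cR_epow (d : Module.Dual K V) (W : Submodule K V) (hd : ∀ x ∈ W, d x = 0) (m : ℕ)
    (x : ExteriorAlgebra K V) (hx : x ∈ epowSub K W m) : cR d x = 0 := by
  have : epowSub K W m ≤ LinearMap.ker (cR d) := by
    refine Submodule.span_le.2 ?_
    rintro _ ⟨w, hw, rfl⟩
    exact cR_ιMulti d m w (fun i => hd _ (hw i))
  exact this hx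

theorem ιMulti_mul_mem (p : ℕ) (u : Fin p → V) (x : V)
    (hx : x ∈ Submodule.span K (Set.range u)) :
    ExteriorAlgebra.ιMulti K p u * ExteriorAlgebra.ι K x = 0 := by
  have : Submodule.span K (Set.range u) ≤
      LinearMap.ker ((LinearMap.mulLeft K (ExteriorAlgebra.ιMulti K p u)) ∘ₗ
        (ExteriorAlgebra.ι K)) := by
    refine Submodule.span_le.2 ?_
    rintro _ ⟨i, rfl⟩
    have h := ιMulti_snoc' (K := K) p (Fin.snoc (α := fun _ => V) u (u i))
    simp only [Fin.snoc_castSucc, Fin.snoc_last] at h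
    change ExteriorAlgebra.ιMulti K p u * ExteriorAlgebra.ι K (u i) = 0
    rw [← h]
    refine AlternatingMap.map_eq_zero_of_eq _ _ (i := i.castSucc) (j := Fin.last p) ?_
      (Fin.castSucc_lt_last i).ne
    simp
  exact this hx

theorem mem_span_of_perp [FiniteDimensional K V]
    (B : LinearMap.BilinForm K V) (hsymm : B.IsSymm) (hB : B.Nondegenerate)
    (p : ℕ) (hdim : Module.finrank K V = 2 * p)
    (u : Fin p → V) (huiso : ∀ i j, B (u i) (u j) = 0)
    (h0 : ExteriorAlgebra.ιMulti K p u ≠ 0) (y : V) (hy : ∀ i, B y (u i) = 0) :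
    y ∈ Submodule.span K (Set.range u) := by
  have hli : LinearIndependent K u := by
    by_contra h
    exact h0 (AlternatingMap.map_linearDependent _ _ h)
  have hfr : Module.finrank K (Submodule.span K (Set.range u)) = p := by
    simpa using finrank_span_eq_card hli
  have key : ∀ z : V, (∀ i, B z (u i) = 0) →
      z ∈ B.orthogonal (Submodule.span K (Set.range u)) := by
    intro z hz
    rw [LinearMap.BilinForm.mem_orthogonal_iff]
    intro n hn
    have : Submodule.span K (Set.range u) ≤ LinearMap.ker (B z) := by
      refine Submodule.span_le.2 ?_
      rintro _ ⟨i, rfl⟩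
      exact hz i
    have h := this hn
    rw [LinearMap.mem_ker] at h
    rw [hsymm.eq]
    exact h
  have hle : Submodule.span K (Set.range u) ≤
      B.orthogonal (Submodule.span K (Set.range u)) := by
    refine Submodule.span_le.2 ?_
    rintro _ ⟨i, rfl⟩
    exact key _ (fun j => huiso i j)
  have heq := Submodule.eq_of_le_of_finrank_eq hle (by
    rw [LinearMap.BilinForm.finrank_orthogonal hB, hfr, hdim]; omega)
  rw [heq]
  exact key y hy

end Helpers

open ExteriorAlgebra in
/-- With `V = V' ⊕ span{e_p, e_{-p}}` and `dim V = 2p` even, if the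
nonzero `ω ∈ Ĝr_iso(p,V)` is written `ω = ω₁ ∧ e_p ∧ e_{-p} + ω₂ ∧ e_p + ω₃ ∧ e_{-p} + ω₄`,
then `ω₁ = 0` implies that at most one of `ω₂, ω₃, ω₄` is nonzero; in particular, the zero
pattern `(ω₁ = 0, ω₂ ≠ 0, ω₃ ≠ 0, ω₄ ≠ 0)` cannot occur. -/
theorem zero_pattern_even (K V : Type) [Field K] [AddCommGroup V] [Module K V]
    [FiniteDimensional K V] (h2 : (2 : K) ≠ 0)
    (B : LinearMap.BilinForm K V) (hsymm : B.IsSymm) (hB : B.Nondegenerate)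
    (hWitt : MaxWittIndex B)
    (p : ℕ) (hdim : Module.finrank K V = 2 * p)
    (V' : Submodule K V) (ep em : V)
    (hep : B ep ep = 0) (hem : B em em = 0) (hpair : B ep em = 1)
    (horth : ∀ x ∈ V', B ep x = 0 ∧ B em x = 0)
    (hcompl : IsCompl V' (Submodule.span K {ep, em}))
    (ω ω1 ω2 ω3 ω4 : ExteriorAlgebra K V)
    (hm1 : ω1 ∈ epowSub K V' (p - 2)) (hm2 : ω2 ∈ epowSub K V' (p - 1))
    (hm3 : ω3 ∈ epowSub K V' (p - 1)) (hm4 : ω4 ∈ epowSub K V' p)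
    (hsum : ω = ω1 * ι K ep * ι K em + ω2 * ι K ep + ω3 * ι K em + ω4)
    (u : Fin p → V) (huiso : ∀ i j, B (u i) (u j) = 0)
    (hωu : ω = ιMulti K p u) (hω0 : ω ≠ 0)
    (h1 : ω1 = 0) :
    (ω2 = 0 ∧ ω3 = 0) ∨ (ω2 = 0 ∧ ω4 = 0) ∨ (ω3 = 0 ∧ ω4 = 0) := by
  subst h1
  have hpair' : B em ep = 1 := by rw [← hpair]; exact hsymm.eq _ _
  have ha : ∀ m x, x ∈ epowSub K V' m → cR (B ep) x = 0 := fun m x hx =>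
    cR_epow _ V' (fun x hx => (horth x hx).1) m x hx
  have hb : ∀ m x, x ∈ epowSub K V' m → cR (B em) x = 0 := fun m x hx =>
    cR_epow _ V' (fun x hx => (horth x hx).2) m x hx
  simp only [zero_mul, zero_add] at hsum
  have hRa : cR (B ep) ω = ω3 := by
    rw [hsum]
    simp [cR_mul, ha _ _ hm2, ha _ _ hm3, ha _ _ hm4, hep, hpair]
  have hRb : cR (B em) ω = ω2 := by
    rw [hsum]
    simp [cR_mul, hb _ _ hm2, hb _ _ hm3, hb _ _ hm4, hem, hpair']
  have hU : ∀ x ∈ Submodule.span K (Set.range u), ω * ι K x = 0 := fun x hx => by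
    rw [hωu]; exact ιMulti_mul_mem p u x hx
  have hA : ∀ x ∈ Submodule.span K (Set.range u), B ep x • ω = ω3 * ι K x := by
    intro x hx
    have h := cR_mul (B ep) ω x
    rw [hU x hx, map_zero, hRa] at h
    exact sub_eq_zero.1 h.symm
  have hC : ∀ x ∈ Submodule.span K (Set.range u), B em x • ω = ω2 * ι K x := by
    intro x hx
    have h := cR_mul (B em) ω x
    rw [hU x hx, map_zero, hRb] at h
    exact sub_eq_zero.1 h.symm
  have hAC : ∀ x ∈ Submodule.span K (Set.range u), B ep x • ω2 = B em x • ω3 := by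
    intro x hx
    have h := congrArg (cR (B em)) (hA x hx)
    rw [map_smul, hRb, cR_mul, hb _ _ hm3] at h
    simpa using h
  have hmem := mem_span_of_perp B hsymm hB p hdim u huiso (hωu ▸ hω0)
  have huU : ∀ i, u i ∈ Submodule.span K (Set.range u) := fun i =>
    Submodule.subset_span ⟨i, rfl⟩
  by_cases ht : ∀ i, B ep (u i) = 0
  · have hU' := hmem ep ht
    right; right
    have e3 : ω3 = 0 := by
      have := hAC ep hU'
      simpa [hep, hpair'] using this.symm
    refine ⟨e3, ?_⟩
    have := hC ep hU'
    rw [hpair', one_smul, hsum, e3] at this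
    simpa using this
  push Not at ht
  obtain ⟨i, hi⟩ := ht
  have e2 : ω2 = ((B ep (u i))⁻¹ * B em (u i)) • ω3 := by
    rw [mul_smul, ← hAC _ (huU i), inv_smul_smul₀ hi]
  by_cases h3 : ω3 = 0
  · left
    exact ⟨by rw [e2, h3, smul_zero], h3⟩
  set c := (B ep (u i))⁻¹ * B em (u i) with hc
  have hU' : em - c • ep ∈ Submodule.span K (Set.range u) := by
    refine hmem _ (fun j => ?_)
    have h := hAC _ (huU j)
    rw [e2, smul_smul] at h
    have h' := smul_left_injective K h3 h
    simp only [map_sub, map_smul, LinearMap.sub_apply, LinearMap.smul_apply, smul_eq_mul]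
    rw [← h']; ring
  right; left
  have h := hAC _ hU'
  have h' : ω2 = (-c) • ω3 := by
    simpa [hep, hem, hpair, hpair'] using h
  have hc0 : c = 0 := by
    have h'' := smul_left_injective K h3 (e2.symm.trans h')
    have : (2 : K) * c = 0 := by linear_combination h''
    exact (mul_eq_zero.1 this).resolve_left h2
  have e20 : ω2 = 0 := by rw [e2, hc0, zero_smul]
  refine ⟨e20, ?_⟩
  rw [hc0, zero_smul, sub_zero] at hU'
  have h4 := hA em hU'
  rw [hpair, one_smul, hsum, e20] at h4
  simpa using h4
end
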